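/- arXiv:1404.1489 — 5 statements merged into one kernel-verified Lean document; each statement's English description precedes it below -/
import Mathlib

section
/- For integers n ≥ 3, 1 ≤ k ≤ n, and real t > 0, the Wronskian W_{k,n}(t) of the n-1 functions x_1', ..., x_{k-1}', x_{k+1}', ..., x_n' (where x_m(t) = t·(log t)^{m-1}) satisfies W_{k,n}(t) = [ (Π_{r=0}^{n-1} r!) / (k-1)! ] · t^{-(n-2)(n-1)/2} · Σ_{j=0}^{n-k} (log t)^{n-k-j}/(n-k-j)!. -/
open Real Finset

/-- `xfun m t = t * (log t)^(m-1)`. -/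
noncomputable def xfun (m : ℕ) : ℝ → ℝ := fun t => t * (Real.log t) ^ (m - 1)

/-- `Wkn n k t` is the Wronskian of the `n-1` functions
`x_1', …, x_{k-1}', x_{k+1}', …, x_n'` at `t`: the determinant of the
`(n-1)×(n-1)` matrix whose `(i,m)` entry is the `(i-1)`-st derivative of the
`m`-th function of this list. -/
noncomputable def Wkn (n k : ℕ) (t : ℝ) : ℝ :=
  (Matrix.of fun i m : Fin (n - 1) =>
    iteratedDeriv (i : ℕ)
      (deriv (xfun (if (m : ℕ) + 1 < k then (m : ℕ) + 1 else (m : ℕ) + 2))) t).det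

open Polynomial in
/-- The polynomial `q` with `deriv (xfun (a + 1)) t = q (log t)` for `t > 0`. -/
noncomputable def logPoly (a : ℕ) : Polynomial ℝ := X ^ a + C (a : ℝ) * X ^ (a - 1)

theorem deriv_xfun_succ (a : ℕ) {t : ℝ} (ht : 0 < t) :
    deriv (xfun (a + 1)) t = (logPoly a).eval (Real.log t) := by
  have h : HasDerivAt (xfun (a + 1))
      (1 * Real.log t ^ a + t * ((a : ℝ) * Real.log t ^ (a - 1) * t⁻¹)) t := by
    have h1 := (hasDerivAt_id t).mul ((Real.hasDerivAt_log ht.ne').pow a)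
    exact h1
  rw [h.deriv]
  simp only [logPoly, Polynomial.eval_add, Polynomial.eval_mul, Polynomial.eval_pow,
    Polynomial.eval_X, Polynomial.eval_C]
  field_simp

theorem derivative_logPoly_succ (a : ℕ) :
    Polynomial.derivative (logPoly (a + 1)) = ((a : ℝ) + 1) • logPoly a := by
  simp only [logPoly, Polynomial.smul_eq_C_mul]
  simp [Polynomial.derivative_X_pow]
  ring

/-- Iterated derivatives of a polynomial in `log t` are given by falling factorials of the
derivative operator. -/
theorem iteratedDeriv_eval_log (p : Polynomial ℝ) (i : ℕ) {t : ℝ} (ht : 0 < t) :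
    iteratedDeriv i (fun s => p.eval (Real.log s)) t =
      t⁻¹ ^ i * (Polynomial.aeval (Polynomial.derivative : Module.End ℝ (Polynomial ℝ))
        (descPochhammer ℝ i) p).eval (Real.log t) := by
  induction i generalizing t with
  | zero => simp
  | succ i ih =>
    rw [iteratedDeriv_succ]
    have hev : iteratedDeriv i (fun s => p.eval (Real.log s)) =ᶠ[nhds t] fun s =>
        s⁻¹ ^ i * (Polynomial.aeval (Polynomial.derivative : Module.End ℝ (Polynomial ℝ))
          (descPochhammer ℝ i) p).eval (Real.log s) := by
      filter_upwards [lt_mem_nhds ht] with s hs using ih hs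
    rw [hev.deriv_eq, descPochhammer_succ_right, mul_comm (descPochhammer ℝ i), map_mul,
      Module.End.mul_apply]
    generalize Polynomial.aeval (Polynomial.derivative : Module.End ℝ (Polynomial ℝ))
          (descPochhammer ℝ i) p = q
    have h := ((hasDerivAt_inv ht.ne').pow i).mul
      ((q.hasDerivAt (Real.log t)).comp t (Real.hasDerivAt_log ht.ne'))
    have h2 := h.deriv
    simp only [Pi.mul_def, Pi.pow_def, Function.comp_def] at h2
    rw [h2]
    simp only [map_sub, Polynomial.aeval_X, map_natCast, LinearMap.sub_apply,
      Module.End.natCast_apply, Polynomial.eval_sub, nsmul_eq_mul, Polynomial.eval_mul,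
      Polynomial.eval_natCast]
    cases i with
    | zero => simp [mul_comm]
    | succ i =>
      simp only [Nat.add_sub_cancel, inv_pow]
      field_simp
      ring

open PowerSeries in
/-- The generating function of the values `(logPoly a).eval L / a!`. -/
noncomputable def logSeries (L : ℝ) : PowerSeries ℝ := (1 + X) * rescale L (exp ℝ)

open PowerSeries in
/-- The inverse of `logSeries`. -/
noncomputable def logSeriesInv (L : ℝ) : PowerSeries ℝ :=
  PowerSeries.mk (fun j => (-1 : ℝ) ^ j) * rescale (-L) (exp ℝ)

open PowerSeries in
theorem constantCoeff_logSeries (L : ℝ) : constantCoeff (logSeries L) = 1 := by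
  rw [logSeries, map_mul, ← coeff_zero_eq_constantCoeff_apply (rescale L (exp ℝ)), coeff_rescale]
  simp

open PowerSeries in
theorem logSeries_mul_inv (L : ℝ) : logSeries L * logSeriesInv L = 1 := by
  have h1 : (1 + X) * PowerSeries.mk (fun j => (-1 : ℝ) ^ j) = 1 := by
    ext n
    cases n with
    | zero => simp [add_mul]
    | succ n => simp [add_mul, coeff_succ_X_mul, coeff_one, pow_succ]
  have h2 : rescale L (exp ℝ) * rescale (-L) (exp ℝ) = 1 := by
    rw [exp_mul_exp_eq_exp_add]; simp
  calc logSeries L * logSeriesInv L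
      = ((1 + X) * PowerSeries.mk (fun j => (-1 : ℝ) ^ j)) *
        (rescale L (exp ℝ) * rescale (-L) (exp ℝ)) := by
          rw [logSeries, logSeriesInv]; ring
    _ = 1 := by rw [h1, h2, one_mul]

open PowerSeries in
theorem coeff_logSeriesInv (L : ℝ) (d : ℕ) :
    coeff d (logSeriesInv L) =
      (-1) ^ d * ∑ j ∈ Finset.range (d + 1), L ^ (d - j) / (Nat.factorial (d - j) : ℝ) := by
  rw [logSeriesInv, coeff_mul, Finset.Nat.sum_antidiagonal_eq_sum_range_succ_mk, Finset.mul_sum]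
  refine Finset.sum_congr rfl fun j hj => ?_
  have hj : j ≤ d := Nat.lt_succ_iff.mp (Finset.mem_range.mp hj)
  obtain ⟨e, rfl⟩ := Nat.exists_eq_add_of_le hj
  simp only [coeff_mk, coeff_rescale, coeff_exp, Nat.add_sub_cancel_left, pow_add]
  rw [neg_pow L e]
  simp
  ring

open PowerSeries in
theorem eval_iterate_derivative_logPoly (L : ℝ) (l a : ℕ) :
    (Polynomial.derivative^[l] (logPoly a)).eval L =
      (Nat.factorial a : ℝ) * coeff a (X ^ l * logSeries L) := by
  induction l generalizing a with
  | zero =>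
    cases a with
    | zero => simp [logPoly, constantCoeff_logSeries]
    | succ a =>
      have h : (Nat.factorial a : ℝ) ≠ 0 := by positivity
      simp [logPoly, logSeries, add_mul, coeff_succ_X_mul, coeff_rescale, coeff_exp,
        Nat.factorial_succ]
      field_simp
  | succ l ih =>
    rw [Function.iterate_succ_apply]
    cases a with
    | zero => simp [logPoly, pow_succ', mul_assoc]
    | succ a =>
      rw [derivative_logPoly_succ, Polynomial.iterate_derivative_smul, Polynomial.eval_smul, ih,
        pow_succ', mul_assoc, coeff_succ_X_mul, Nat.factorial_succ]
      push_cast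
      simp [mul_assoc]

/-- The truncated upper triangular Toeplitz matrix of a power series. -/
noncomputable def toeplitz {R : Type*} [CommRing R] (N : ℕ) (f : PowerSeries R) :
    Matrix (Fin N) (Fin N) R :=
  Matrix.of fun l a => PowerSeries.coeff (a : ℕ) (PowerSeries.X ^ (l : ℕ) * f)

theorem toeplitz_mul {R : Type*} [CommRing R] (N : ℕ) (f g : PowerSeries R) :
    toeplitz N f * toeplitz N g = toeplitz N (f * g) := by
  ext l a
  simp only [toeplitz, Matrix.mul_apply, Matrix.of_apply]
  rw [← mul_assoc, PowerSeries.coeff_mul (a : ℕ) _ g,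
    Finset.Nat.sum_antidiagonal_eq_sum_range_succ_mk,
    Fin.sum_univ_eq_sum_range (fun b => PowerSeries.coeff b (PowerSeries.X ^ (l : ℕ) * f) *
      PowerSeries.coeff (a : ℕ) (PowerSeries.X ^ b * g)) N]
  symm
  refine Finset.sum_subset_zero_on_sdiff (Finset.range_subset_range.mpr a.isLt) ?_ ?_
  · intro b hb
    have : ¬ b ≤ (a : ℕ) := by simp at hb; omega
    simp [PowerSeries.coeff_X_pow_mul', this]
  · intro b hb
    have : b ≤ (a : ℕ) := by simp at hb; omega
    rw [mul_comm (PowerSeries.X ^ b) g, PowerSeries.coeff_mul_X_pow', if_pos this]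

theorem toeplitz_one {R : Type*} [CommRing R] (N : ℕ) :
    toeplitz N (1 : PowerSeries R) = 1 := by
  ext l a
  simp [toeplitz, PowerSeries.coeff_X_pow, Matrix.one_apply, Fin.ext_iff, eq_comm]

theorem det_toeplitz {R : Type*} [CommRing R] (N : ℕ) (f : PowerSeries R) :
    (toeplitz N f).det = PowerSeries.constantCoeff f ^ N := by
  rw [Matrix.det_of_isUpperTriangular]
  · simp [toeplitz, PowerSeries.coeff_X_pow_mul']
  · intro l a h
    have : ¬ (l : ℕ) ≤ a := by simpa using h
    rw [toeplitz, Matrix.of_apply, PowerSeries.coeff_X_pow_mul', if_neg this]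

theorem det_submatrix_toeplitz_logSeries (N : ℕ) (K : Fin (N + 1)) (L : ℝ) :
    ((toeplitz (N + 1) (logSeries L)).submatrix Fin.castSucc K.succAbove).det =
      ∑ j ∈ Finset.range (N - K + 1), L ^ (N - K - j) / (Nat.factorial (N - K - j) : ℝ) := by
  set T := toeplitz (N + 1) (logSeries L) with hT
  have hdet : T.det = 1 := by rw [hT, det_toeplitz, constantCoeff_logSeries, one_pow]
  have hinv : T * toeplitz (N + 1) (logSeriesInv L) = 1 := by
    rw [hT, toeplitz_mul, logSeries_mul_inv, toeplitz_one]
  have hadj : T.adjugate = toeplitz (N + 1) (logSeriesInv L) := by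
    calc T.adjugate = T.adjugate * (T * toeplitz (N + 1) (logSeriesInv L)) := by
          rw [hinv, mul_one]
      _ = _ := by rw [← mul_assoc, Matrix.adjugate_mul, hdet, one_smul, one_mul]
  have h := Matrix.adjugate_fin_succ_eq_det_submatrix T K (Fin.last N)
  have hK : (K : ℕ) ≤ N := Nat.lt_succ_iff.mp K.isLt
  have hs : (-1 : ℝ) ^ (N + K : ℕ) = (-1) ^ (N - K : ℕ) := by
    rw [show N + (K : ℕ) = 2 * K + (N - K) by omega, pow_add, pow_mul]
    simp
  rw [hadj, Fin.succAbove_last] at h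
  simp only [toeplitz, Matrix.of_apply, Fin.val_last, PowerSeries.coeff_X_pow_mul', if_pos hK,
    coeff_logSeriesInv, hs] at h
  exact (mul_left_cancel₀ (pow_ne_zero _ (by norm_num)) h).symm

/-- The Wronskian in `t` of polynomials in `log t`, in terms of the Wronskian in `log t`. -/
theorem det_iteratedDeriv_eval_log (N : ℕ) (p : Fin N → Polynomial ℝ) {t : ℝ} (ht : 0 < t) :
    (Matrix.of fun i m : Fin N =>
      iteratedDeriv (i : ℕ) (fun s => (p m).eval (Real.log s)) t).det =
      t⁻¹ ^ (N * (N - 1) / 2) * (Matrix.of fun i m : Fin N =>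
        (Polynomial.derivative^[(i : ℕ)] (p m)).eval (Real.log t)).det := by
  have hdeg (i : ℕ) : (descPochhammer ℝ i).natDegree = i := descPochhammer_natDegree ℝ i
  have hA : (Matrix.of fun l i : Fin N => (descPochhammer ℝ i).coeff l).det = 1 :=
    Matrix.det_matrixOfPolynomials (fun i : Fin N => descPochhammer ℝ i) (fun i => hdeg i)
      (fun i => monic_descPochhammer ℝ i)
  rw [← Matrix.det_transpose] at hA
  have hmat : (Matrix.of fun i m : Fin N =>
      iteratedDeriv (i : ℕ) (fun s => (p m).eval (Real.log s)) t) =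
      Matrix.of fun i m : Fin N => t⁻¹ ^ (i : ℕ) *
        ((Matrix.of fun l i : Fin N => (descPochhammer ℝ i).coeff l).transpose *
        (Matrix.of fun i m : Fin N =>
        (Polynomial.derivative^[(i : ℕ)] (p m)).eval (Real.log t))) i m := by
    ext i m
    rw [Matrix.of_apply, Matrix.of_apply, iteratedDeriv_eval_log _ _ ht, Matrix.mul_apply]
    congr 1
    simp only [Matrix.transpose_apply, Matrix.of_apply]
    rw [Fin.sum_univ_eq_sum_range (fun l => (descPochhammer ℝ i).coeff l *
      (Polynomial.derivative^[l] (p m)).eval (Real.log t)) N,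
      Polynomial.aeval_eq_sum_range' (n := N) (by rw [hdeg]; exact i.isLt),
      LinearMap.sum_apply, Polynomial.eval_finsetSum]
    simp [Module.End.pow_apply]
  rw [hmat, Matrix.det_mul_column, Matrix.det_mul, hA, one_mul, Finset.prod_pow_eq_pow_sum,
    Fin.sum_univ_eq_sum_range (fun i => i) N, Finset.sum_range_id]

theorem stmt_11 (n k : ℕ) (hn : 3 ≤ n) (hk1 : 1 ≤ k) (hk2 : k ≤ n) (t : ℝ) (ht : 0 < t) :
    Wkn n k t =
      ((∏ r ∈ Finset.range n, (Nat.factorial r : ℝ)) / (Nat.factorial (k - 1) : ℝ)) *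
        (1 / t ^ ((n - 2) * (n - 1) / 2)) *
        ∑ j ∈ Finset.range (n - k + 1),
          (Real.log t) ^ (n - k - j) / (Nat.factorial (n - k - j) : ℝ) := by
  obtain ⟨N, rfl⟩ : ∃ N, n = N + 1 := ⟨n - 1, by omega⟩
  obtain ⟨K, rfl⟩ : ∃ K, k = K + 1 := ⟨k - 1, by omega⟩
  lift K to Fin (N + 1) using by omega
  have hW : Wkn (N + 1) (K + 1) t = (Matrix.of fun i m : Fin N =>
      iteratedDeriv (i : ℕ) (fun s => (logPoly (K.succAbove m)).eval (Real.log s)) t).det := by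
    rw [Wkn]
    congr 1
    ext i m
    simp only [Matrix.of_apply]
    refine Filter.EventuallyEq.iteratedDeriv_eq _ ?_
    have hidx : (if (m : ℕ) + 1 < K + 1 then (m : ℕ) + 1 else (m : ℕ) + 2) =
        (K.succAbove m : ℕ) + 1 := by
      simp only [Fin.succAbove, Fin.lt_def, Fin.val_castSucc, add_lt_add_iff_right]
      split_ifs <;> simp
    filter_upwards [lt_mem_nhds ht] with s hs
    exact (congrArg (fun a => deriv (xfun a) s) hidx).trans (deriv_xfun_succ _ hs)
  have hB : (Matrix.of fun i m : Fin N =>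
      (Polynomial.derivative^[(i : ℕ)] (logPoly (K.succAbove m))).eval (Real.log t)) =
      Matrix.of fun i m : Fin N => (Nat.factorial (K.succAbove m) : ℝ) *
        ((toeplitz (N + 1) (logSeries (Real.log t))).submatrix Fin.castSucc K.succAbove) i m := by
    ext i m
    simp [eval_iterate_derivative_logPoly, toeplitz]
  have hprod : ∏ r ∈ Finset.range (N + 1), (Nat.factorial r : ℝ) =
      (Nat.factorial K : ℝ) * ∏ m : Fin N, (Nat.factorial (K.succAbove m) : ℝ) := by
    rw [← Fin.prod_univ_eq_prod_range, Fin.prod_univ_succAbove _ K]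
  have hfac : (Nat.factorial K : ℝ) ≠ 0 := by positivity
  rw [hW, det_iteratedDeriv_eval_log N _ ht, hB, Matrix.det_mul_row,
    det_submatrix_toeplitz_logSeries, hprod]
  simp only [Nat.add_sub_cancel, Nat.add_sub_add_right, show N + 1 - 2 = N - 1 by omega,
    mul_comm (N - 1) N, mul_div_cancel_left₀ _ hfac, inv_pow, one_div]
  ring
end

section
/- For integers n ≥ 2, 1 ≤ k ≤ n-1, and real t > 0, the Wronskians W_{k,n} satisfy the recursion W_{k+1,n+1}(t) = (n!/k) · t^{-(n-1)} · W_{k,n}(t). -/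
open Real Finset

/-- A common factor comes out of the Wronskian of `N` functions as its `N`-th power. -/
theorem det_iteratedDeriv_mul {N : ℕ} (f : ℝ → ℝ) (g : Fin N → ℝ → ℝ) (t : ℝ)
    (hf : ∀ i : ℕ, ContDiffAt ℝ i f t) (hg : ∀ (j : Fin N) (i : ℕ), ContDiffAt ℝ i (g j) t) :
    (Matrix.of fun i j : Fin N => iteratedDeriv (i : ℕ) (fun s => f s * g j s) t).det =
      f t ^ N * (Matrix.of fun i j : Fin N => iteratedDeriv (i : ℕ) (g j) t).det := by
  let A : Matrix (Fin N) (Fin N) ℝ := Matrix.of fun i l =>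
    ((i : ℕ).choose l : ℝ) * iteratedDeriv ((i : ℕ) - l) f t
  have hA : A.det = f t ^ N := by
    rw [Matrix.det_of_isLowerTriangular A]
    · simp [A]
    · intro i j hij
      have hij' : (i : ℕ) < j := hij
      simp [A, Nat.choose_eq_zero_of_lt hij']
  rw [← hA, ← Matrix.det_mul]
  congr 1
  ext i j
  have hfg : (fun s => f s * g j s) = g j * f := by
    ext s
    simp [mul_comm]
  rw [Matrix.mul_apply, Matrix.of_apply, hfg, iteratedDeriv_mul (hg j i) (hf i)]
  simp only [A, Matrix.of_apply]
  rw [Fin.sum_univ_eq_sum_range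
    (fun l => ((i : ℕ).choose l : ℝ) * iteratedDeriv ((i : ℕ) - l) f t * iteratedDeriv l (g j) t) N]
  refine Finset.sum_subset_zero_on_sdiff (fun l hl => ?_) (fun l hl => ?_) (fun l _ => by ring)
  · have := i.isLt
    simp only [Finset.mem_range] at hl ⊢
    omega
  · simp only [Finset.mem_sdiff, Finset.mem_range] at hl
    rw [Nat.choose_eq_zero_of_lt (by omega)]
    simp

theorem hasDerivAt_xfun (q : ℕ) {s : ℝ} (hs : 0 < s) :
    HasDerivAt (xfun (q + 1)) (Real.log s ^ q + q * Real.log s ^ (q - 1)) s := by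
  have h := (hasDerivAt_id s).mul ((Real.hasDerivAt_log hs.ne').pow q)
  refine HasDerivAt.congr_deriv (f := xfun (q + 1)) h ?_
  simp only [Pi.pow_apply, id_eq]
  field_simp

theorem deriv_xfun_eventuallyEq (q : ℕ) {t : ℝ} (ht : 0 < t) :
    deriv (xfun (q + 1)) =ᶠ[nhds t] fun s => Real.log s ^ q + q * Real.log s ^ (q - 1) := by
  filter_upwards [lt_mem_nhds ht] with s hs
  exact (hasDerivAt_xfun q hs).deriv

theorem contDiffAt_deriv_xfun (q i : ℕ) {t : ℝ} (ht : 0 < t) :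
    ContDiffAt ℝ i (deriv (xfun (q + 1))) t := by
  refine ContDiffAt.congr_of_eventuallyEq ?_ (deriv_xfun_eventuallyEq q ht)
  have hl : ContDiffAt ℝ i Real.log t := Real.contDiffAt_log.2 ht.ne'
  exact (hl.pow q).add (contDiffAt_const.mul (hl.pow (q - 1)))

theorem deriv_deriv_xfun_eventuallyEq (q : ℕ) {t : ℝ} (ht : 0 < t) :
    deriv (deriv (xfun (q + 2))) =ᶠ[nhds t]
      fun s => s⁻¹ * (((q + 1 : ℕ) : ℝ) * deriv (xfun (q + 1)) s) := by
  filter_upwards [lt_mem_nhds ht] with s hs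
  rw [(deriv_xfun_eventuallyEq (q + 1) hs).deriv_eq, (hasDerivAt_xfun q hs).deriv]
  have hl := Real.hasDerivAt_log hs.ne'
  have h := (hl.pow (q + 1)).add ((hl.pow q).const_mul ((q + 1 : ℕ) : ℝ))
  refine h.deriv.trans ?_
  simp only [Nat.add_sub_cancel]
  ring

theorem prod_skip (N k : ℕ) (hk1 : 1 ≤ k) (hk2 : k ≤ N + 1) :
    ∏ j : Fin N, (((if (j : ℕ) + 1 < k then (j : ℕ) + 1 else (j : ℕ) + 2 : ℕ)) : ℝ) =
      ((N + 1).factorial : ℝ) / k := by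
  have hk : (k : ℝ) ≠ 0 := by positivity
  rw [eq_div_iff hk, ← Finset.prod_range_add_one_eq_factorial,
    ← Fin.prod_univ_eq_prod_range (fun i => i + 1) (N + 1),
    Fin.prod_univ_succAbove _ (⟨k - 1, by omega⟩ : Fin (N + 1))]
  push_cast
  rw [mul_comm]
  congr 1
  · simp [Nat.cast_sub hk1]
  · refine Finset.prod_congr rfl fun j _ => ?_
    norm_cast
    simp only [Fin.succAbove, Fin.lt_def, Fin.val_castSucc]
    split_ifs <;> simp <;> omega

theorem stmt_12 (n k : ℕ) (hn : 2 ≤ n) (hk1 : 1 ≤ k) (hk2 : k ≤ n - 1) (t : ℝ) (ht : 0 < t) :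
    Wkn (n + 1) (k + 1) t =
      ((Nat.factorial n : ℝ) / (k : ℝ)) * (1 / t ^ (n - 1)) * Wkn n k t := by
  obtain ⟨N, rfl⟩ : ∃ N, n = N + 1 := ⟨n - 1, by omega⟩
  let p : Fin N → ℕ := fun j => if (j : ℕ) + 1 < k then (j : ℕ) + 1 else (j : ℕ) + 2
  have hp : ∀ j, ∃ q, p j = q + 1 := fun j => by
    refine ⟨p j - 1, ?_⟩
    simp only [p]
    split_ifs <;> omega
  have hdet : Wkn (N + 1 + 1) (k + 1) t =
      (Matrix.of fun i j : Fin N =>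
        iteratedDeriv (i : ℕ) (deriv (deriv (xfun (p j + 1)))) t).det := by
    unfold Wkn
    change Matrix.det (n := Fin (N + 1)) _ = _
    have h0 : (if ((0 : Fin (N + 1)) : ℕ) + 1 < k + 1 then ((0 : Fin (N + 1)) : ℕ) + 1
        else ((0 : Fin (N + 1)) : ℕ) + 2) = 0 + 1 := by
      rw [if_pos (by simp; omega)]
      simp
    have h1 : deriv (xfun (0 + 1)) = fun _ => 1 := by
      have : xfun (0 + 1) = fun s => s := by
        ext s
        simp [xfun]
      rw [this]
      exact deriv_id'
    rw [Matrix.det_succ_column_zero, Fin.sum_univ_succ, Finset.sum_eq_zero]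
    · simp only [Matrix.of_apply, h0, h1]
      simp only [Fin.val_zero, pow_zero, iteratedDeriv_zero, mul_one, one_mul, add_zero]
      congr 1
      ext i j
      simp only [Matrix.submatrix_apply, Matrix.of_apply, Fin.succAbove_zero, Fin.val_succ]
      rw [iteratedDeriv_succ']
      congr 4
      simp only [p]
      split_ifs <;> omega
    · intro i _
      simp only [Matrix.of_apply, h0, h1]
      simp [iteratedDeriv_const]
  have hentry : ∀ i j : Fin N, iteratedDeriv (i : ℕ) (deriv (deriv (xfun (p j + 1)))) t =
      iteratedDeriv (i : ℕ) (fun s => s⁻¹ * ((p j : ℝ) * deriv (xfun (p j)) s)) t := by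
    intro i j
    obtain ⟨q, hq⟩ := hp j
    rw [hq]
    exact (deriv_deriv_xfun_eventuallyEq q ht).iteratedDeriv_eq i
  have hsmooth : ∀ (j : Fin N) (i : ℕ), ContDiffAt ℝ i (deriv (xfun (p j))) t := by
    intro j i
    obtain ⟨q, hq⟩ := hp j
    rw [hq]
    exact contDiffAt_deriv_xfun q i ht
  rw [hdet]
  simp_rw [hentry]
  rw [det_iteratedDeriv_mul (fun s => s⁻¹) (fun j s => (p j : ℝ) * deriv (xfun (p j)) s) t
    (fun i => contDiffAt_inv ℝ ht.ne') (fun j i => contDiffAt_const.mul (hsmooth j i))]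
  have hcol : (Matrix.of fun i j : Fin N =>
      iteratedDeriv (i : ℕ) (fun s => (p j : ℝ) * deriv (xfun (p j)) s) t).det =
      (∏ j, (p j : ℝ)) * Wkn (N + 1) k t := by
    refine Eq.trans ?_ (Matrix.det_mul_row (fun j => (p j : ℝ)) _)
    congr 1
    ext i j
    simp only [Matrix.of_apply]
    exact iteratedDeriv_const_mul_field _ _
  rw [hcol, prod_skip N k hk1 (by omega), Nat.add_sub_cancel, inv_pow, one_div]
  ring
end

section
/- For integers n ≥ 3 and real numbers 0 < a_1 < a_2 < ... < a_n, the determinant of the n×n matrix whose (i,j) entry is (-1)^{j+1}·W_{j,n}(a_i) equals (Π_{r=0}^{n-1} r!)^{n-2} · [ Π_{1 ≤ i < j ≤ n} (log a_j − log a_i) ] / [ Π_{j=1}^{n} a_j^{(n-1)(n-2)/2} ]. -/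
open Real Finset

namespace LogWronskian

open Polynomial

/-- The polynomial `p` with `x_{m+1}'(t) = p (log t)`. -/
noncomputable def derivPoly (m : ℕ) : ℝ[X] := X ^ m + derivative (X ^ m)

/-- Operator on polynomials describing iterated derivatives of `q ∘ log`:
the `i`-th derivative of `q (log t)` is `t ^ (-i) * (logDerivOp i q) (log t)`. -/
noncomputable def logDerivOp : ℕ → ℝ[X] →ₗ[ℝ] ℝ[X]
  | 0 => LinearMap.id
  | i + 1 => (derivative - (i : ℝ) • LinearMap.id) ∘ₗ logDerivOp i

/-- The truncated exponential series. -/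
noncomputable def truncExp (n : ℕ) (s : ℝ) : ℝ :=
  ∑ l ∈ range (n + 1), s ^ l / (l.factorial : ℝ)

lemma deriv_xfun_succ (m : ℕ) {t : ℝ} (ht : 0 < t) :
    deriv (xfun (m + 1)) t = (derivPoly m).eval (log t) := by
  have h1 : HasDerivAt (fun t : ℝ => t * (log t) ^ m)
      (1 * (log t) ^ m + t * (m * (log t) ^ (m - 1) * t⁻¹)) t :=
    (hasDerivAt_id t).mul ((hasDerivAt_log ht.ne').pow m)
  have h2 : xfun (m + 1) = fun t : ℝ => t * (log t) ^ m := by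
    funext t
    simp [xfun]
  rw [h2, h1.deriv, derivPoly]
  simp only [derivative_X_pow, eval_add, eval_mul, eval_pow, eval_X, eval_C]
  field_simp

lemma iteratedDeriv_eval_log (q : ℝ[X]) (i : ℕ) {t : ℝ} (ht : 0 < t) :
    iteratedDeriv i (fun u => q.eval (log u)) t
      = (t ^ i)⁻¹ * (logDerivOp i q).eval (log t) := by
  induction i generalizing t with
  | zero => simp [logDerivOp]
  | succ i ih =>
    rw [iteratedDeriv_succ]
    have h : iteratedDeriv i (fun u => q.eval (log u))
        =ᶠ[nhds t] fun u => (u ^ i)⁻¹ * (logDerivOp i q).eval (log u) := by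
      filter_upwards [lt_mem_nhds ht] with u hu using ih hu
    rw [h.deriv_eq]
    have h1 : HasDerivAt (fun u : ℝ => (u ^ i)⁻¹ * (logDerivOp i q).eval (log u))
        (-(i * t ^ (i - 1)) / (t ^ i) ^ 2 * (logDerivOp i q).eval (log t)
          + (t ^ i)⁻¹ * ((derivative (logDerivOp i q)).eval (log t) * t⁻¹)) t :=
      ((hasDerivAt_pow i t).inv (pow_ne_zero _ ht.ne')).mul
        (((logDerivOp i q).hasDerivAt (log t)).comp t (hasDerivAt_log ht.ne'))
    rw [h1.deriv]
    simp only [logDerivOp, LinearMap.comp_apply, LinearMap.sub_apply, LinearMap.smul_apply,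
      LinearMap.id_apply, eval_sub, eval_smul, smul_eq_mul]
    rcases i with _ | i
    · simp
      ring
    · simp only [Nat.add_sub_cancel]
      field_simp
      ring

lemma iteratedDeriv_deriv_xfun (m i : ℕ) {t : ℝ} (ht : 0 < t) :
    iteratedDeriv i (deriv (xfun (m + 1))) t
      = (t ^ i)⁻¹ * (logDerivOp i (derivPoly m)).eval (log t) := by
  rw [← iteratedDeriv_eval_log _ _ ht]
  apply Filter.EventuallyEq.iteratedDeriv_eq
  filter_upwards [lt_mem_nhds ht] with u hu using deriv_xfun_succ m hu

lemma exists_logDerivOp_X_sub_C_pow (s : ℝ) (i k : ℕ) :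
    ∃ r : ℝ[X], logDerivOp i ((X - C s) ^ (k + i)) = (X - C s) ^ k * r ∧
      r.eval s = ((k + i).descFactorial i : ℝ) := by
  suffices h : ∀ d i k, k + i = d → ∃ r : ℝ[X],
      logDerivOp i ((X - C s) ^ d) = (X - C s) ^ k * r ∧
      r.eval s = (d.descFactorial i : ℝ) from h _ i k rfl
  intro d i
  induction i with
  | zero =>
    rintro k rfl
    exact ⟨1, by simp [logDerivOp], by simp⟩
  | succ i ih =>
    rintro k hk
    obtain ⟨r, hr, hr'⟩ := ih (k + 1) (by omega)
    refine ⟨C ((k : ℝ) + 1) * r + (X - C s) * (derivative r - C (i : ℝ) * r), ?_, ?_⟩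
    · simp only [logDerivOp, LinearMap.comp_apply, LinearMap.sub_apply, LinearMap.smul_apply,
        LinearMap.id_apply, hr, derivative_mul, derivative_X_sub_C_pow, smul_eq_C_mul]
      simp
      ring
    · simp [hr', Nat.descFactorial_succ, show d - i = k + 1 by omega]

lemma eval_logDerivOp_of_lt (s : ℝ) {i d : ℕ} (h : i < d) :
    (logDerivOp i ((X - C s) ^ d)).eval s = 0 := by
  obtain ⟨k, rfl⟩ := Nat.exists_eq_add_of_lt h
  obtain ⟨r, hr, -⟩ := exists_logDerivOp_X_sub_C_pow s i (k + 1)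
  rw [show i + k + 1 = k + 1 + i by omega, hr]
  simp

lemma eval_logDerivOp_self (s : ℝ) (i : ℕ) :
    (logDerivOp i ((X - C s) ^ i)).eval s = (i.factorial : ℝ) := by
  obtain ⟨r, hr, hr'⟩ := exists_logDerivOp_X_sub_C_pow s i 0
  rw [zero_add] at hr hr'
  rw [hr]
  simp [hr', Nat.descFactorial_self]

lemma natDegree_derivPoly_le (m : ℕ) : (derivPoly m).natDegree ≤ m := by
  refine (natDegree_add_le _ _).trans (max_le (by simp) ?_)
  exact (natDegree_derivative_le _).trans (by simp)

lemma coeff_derivPoly_self (m : ℕ) : (derivPoly m).coeff m = 1 := by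
  simp [derivPoly, coeff_derivative, coeff_X_pow]

/-- Taylor coefficients at `s` of the polynomials `derivPoly m`. -/
noncomputable def taylorMatrix (N : ℕ) (s : ℝ) : Matrix (Fin (N + 1)) (Fin (N + 1)) ℝ :=
  Matrix.of fun d m => (taylor s (derivPoly m)).coeff d

lemma coeff_taylor_derivPoly_of_lt (s : ℝ) {d m : ℕ} (h : m < d) :
    (taylor s (derivPoly m)).coeff d = 0 :=
  coeff_eq_zero_of_natDegree_lt
    ((natDegree_taylor _ _).trans_le (natDegree_derivPoly_le m) |>.trans_lt h)

lemma coeff_taylor_derivPoly_self (s : ℝ) (m : ℕ) :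
    (taylor s (derivPoly m)).coeff m = 1 := by
  have h : (derivPoly m).natDegree = m :=
    le_antisymm (natDegree_derivPoly_le m)
      (le_natDegree_of_ne_zero (by simp [coeff_derivPoly_self]))
  have := coeff_taylor_natDegree s (derivPoly m)
  rwa [leadingCoeff, h, coeff_derivPoly_self] at this

lemma det_taylorMatrix (N : ℕ) (s : ℝ) : (taylorMatrix N s).det = 1 := by
  rw [Matrix.det_of_isUpperTriangular]
  · simp [taylorMatrix, coeff_taylor_derivPoly_self]
  · intro i j hij
    exact coeff_taylor_derivPoly_of_lt s hij

lemma sum_monomials_eq (n : ℕ) (s : ℝ) :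
    ∑ m ∈ range (n + 1), C ((-1 : ℝ) ^ m / m.factorial * (s ^ (n - m) / (n - m).factorial)) * X ^ m
      = C ((-1 : ℝ) ^ n / n.factorial) * (X - C s) ^ n := by
  rw [sub_eq_add_neg, add_pow, mul_sum]
  refine sum_congr rfl fun m hm => ?_
  have hm : m ≤ n := Nat.lt_succ_iff.mp (mem_range.mp hm)
  have h : (-1 : ℝ) ^ m / m.factorial * (s ^ (n - m) / (n - m).factorial)
      = (-1 : ℝ) ^ n / n.factorial * ((-s) ^ (n - m) * n.choose m) := by
    rw [Nat.cast_choose ℝ hm, neg_pow s]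
    obtain ⟨k, rfl⟩ := Nat.exists_eq_add_of_le hm
    have e : (-1 : ℝ) ^ k * (-1) ^ k = 1 := by rw [← mul_pow]; simp
    have h1 : ((m + k).factorial : ℝ) ≠ 0 := by positivity
    have h2 : (m.factorial : ℝ) ≠ 0 := by positivity
    have h3 : (k.factorial : ℝ) ≠ 0 := by positivity
    rw [Nat.add_sub_cancel_left, pow_add]
    field_simp
    linear_combination (-s ^ k) * e
  rw [h]
  simp only [C_mul, C_pow, C_neg, map_natCast]
  ring

lemma sum_truncExp_derivPoly (N : ℕ) (s : ℝ) :
    ∑ m ∈ range (N + 1), C ((-1 : ℝ) ^ m / m.factorial * truncExp (N - m) s) * derivPoly m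
      = C ((-1 : ℝ) ^ N / N.factorial) * (X - C s) ^ N := by
  induction N with
  | zero => simp [truncExp, derivPoly]
  | succ N ih =>
    have hD : ∑ m ∈ range (N + 2), C ((-1 : ℝ) ^ m / m.factorial *
          (s ^ (N + 1 - m) / (N + 1 - m).factorial)) * derivPoly m
        = C ((-1 : ℝ) ^ (N + 1) / (N + 1).factorial) * (X - C s) ^ (N + 1)
          - C ((-1 : ℝ) ^ N / N.factorial) * (X - C s) ^ N := by
      have h := sum_monomials_eq (N + 1) s
      have h' := congrArg derivative h
      simp only [derivative_sum, derivative_C_mul, derivative_X_sub_C_pow] at h'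
      simp only [derivPoly, mul_add, sum_add_distrib]
      rw [h, h']
      have hc : (-1 : ℝ) ^ (N + 1) / (N + 1).factorial * (N + 1 : ℕ)
          = -((-1) ^ N / N.factorial) := by
        rw [Nat.factorial_succ, pow_succ]
        push_cast
        field_simp
      rw [Nat.add_sub_cancel, ← mul_assoc, ← C_mul, hc, C_neg, neg_mul, ← sub_eq_add_neg]
    have hstep : ∀ m ∈ range (N + 1), truncExp (N + 1 - m) s
        = truncExp (N - m) s + s ^ (N + 1 - m) / (N + 1 - m).factorial := by
      intro m hm
      have := mem_range.mp hm
      rw [truncExp, show N + 1 - m = N - m + 1 by omega, sum_range_succ]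
      rfl
    rw [sum_range_succ, sum_congr rfl fun m hm => by rw [hstep m hm, mul_add, C_add, add_mul],
      sum_add_distrib, ih]
    rw [sum_range_succ] at hD
    simp only [Nat.sub_self, truncExp, zero_add, sum_range_one] at hD ⊢
    linear_combination hD

lemma taylorMatrix_mulVec (N : ℕ) (s : ℝ) :
    (taylorMatrix N s).mulVec
        (fun m => (-1 : ℝ) ^ (m : ℕ) / (m : ℕ).factorial * truncExp (N - m) s)
      = Pi.single (Fin.last N) ((-1 : ℝ) ^ N / N.factorial) := by
  have h := congrArg (taylor s) (sum_truncExp_derivPoly N s)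
  funext d
  have hd := congrArg (fun q : ℝ[X] => q.coeff d) h
  simp only [map_sum, finsetSum_coeff, taylor_mul, taylor_C, coeff_C_mul, taylor_pow, map_sub,
    taylor_X, add_sub_cancel_right, coeff_X_pow] at hd
  rw [Finset.sum_range] at hd
  simp only [Matrix.mulVec, dotProduct, taylorMatrix, Matrix.of_apply]
  rw [sum_congr rfl fun m _ => mul_comm _ _, hd]
  by_cases hdN : d = Fin.last N
  · subst hdN
    simp
  · rw [Pi.single_eq_of_ne hdN, if_neg, mul_zero]
    exact fun h => hdN (Fin.ext h)

lemma det_taylorMatrix_submatrix (N : ℕ) (s : ℝ) (k : Fin (N + 1)) :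
    ((taylorMatrix N s).submatrix Fin.castSucc k.succAbove).det
      = N.factorial / (k : ℕ).factorial * truncExp (N - k) s := by
  have h := congrArg ((taylorMatrix N s).adjugate.mulVec) (taylorMatrix_mulVec N s)
  rw [Matrix.mulVec_mulVec, Matrix.adjugate_mul, det_taylorMatrix, one_smul, Matrix.one_mulVec] at h
  have hk := congrFun h k
  rw [Matrix.mulVec_single, Pi.smul_apply, Matrix.col_apply,
    Matrix.adjugate_fin_succ_eq_det_submatrix, Fin.succAbove_last] at hk
  simp only [MulOpposite.smul_eq_mul_unop, MulOpposite.unop_op, Fin.val_last] at hk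
  have e : (-1 : ℝ) ^ N * (-1) ^ N = 1 := by rw [← mul_pow]; simp
  have h1 : (N.factorial : ℝ) ≠ 0 := by positivity
  have h2 : ((k : ℕ).factorial : ℝ) ≠ 0 := by positivity
  rw [pow_add] at hk
  field_simp at hk ⊢
  linear_combination -hk - ((k : ℕ).factorial : ℝ) *
    ((taylorMatrix N s).submatrix Fin.castSucc k.succAbove).det * e

lemma derivPoly_eq_sum {N m : ℕ} (h : m ≤ N) (s : ℝ) :
    derivPoly m = ∑ d : Fin (N + 1), (taylor s (derivPoly m)).coeff d • (X - C s) ^ (d : ℕ) := by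
  conv_lhs => rw [← sum_taylor_eq (derivPoly m) s]
  rw [sum_over_range' _ (by simp) (N + 1), Finset.sum_range]
  · simp only [smul_eq_C_mul]
  · rw [natDegree_taylor]
    exact Nat.lt_succ_of_le ((natDegree_derivPoly_le m).trans h)

lemma Wkn_succ (N : ℕ) (k : Fin (N + 1)) {t : ℝ} (ht : 0 < t) :
    Wkn (N + 1) (k + 1) t = (∏ r ∈ range (N + 1), (r.factorial : ℝ)) *
      (t ^ (N * (N - 1) / 2))⁻¹ * ((k : ℕ).factorial : ℝ)⁻¹ * truncExp (N - k) (log t) := by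
  set L : Matrix (Fin N) (Fin N) ℝ := Matrix.of fun i d =>
    (t ^ (i : ℕ))⁻¹ * (logDerivOp i ((X - C (log t)) ^ (d : ℕ))).eval (log t) with hL
  have hdetL : L.det = (∏ r ∈ range N, (r.factorial : ℝ)) * (t ^ (N * (N - 1) / 2))⁻¹ := by
    rw [Matrix.det_of_isLowerTriangular]
    · simp only [hL, Matrix.of_apply, eval_logDerivOp_self]
      rw [prod_mul_distrib, mul_comm, ← Finset.prod_range (fun r => (r.factorial : ℝ)),
        ← Finset.prod_range (fun r => (t ^ r)⁻¹), prod_inv_distrib, prod_pow_eq_pow_sum,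
        sum_range_id]
    · intro i j hij
      simp [hL, eval_logDerivOp_of_lt (log t) (show (i : ℕ) < j from hij)]
  have hmul : (Matrix.of fun i m : Fin N => iteratedDeriv (i : ℕ)
      (deriv (xfun (if (m : ℕ) + 1 < k + 1 then (m : ℕ) + 1 else (m : ℕ) + 2))) t)
      = L * (taylorMatrix N (log t)).submatrix Fin.castSucc k.succAbove := by
    ext i m
    have hm : (if (m : ℕ) + 1 < k + 1 then (m : ℕ) + 1 else (m : ℕ) + 2)
        = (k.succAbove m : ℕ) + 1 := by
      simp only [Fin.succAbove, Fin.lt_def, Fin.val_castSucc, Nat.add_lt_add_iff_right]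
      split_ifs <;> rfl
    rw [Matrix.of_apply, hm, iteratedDeriv_deriv_xfun _ _ ht, Matrix.mul_apply,
      derivPoly_eq_sum (Fin.is_le _) (log t), map_sum, eval_finsetSum, Fin.sum_univ_castSucc]
    simp only [map_smul, eval_smul, smul_eq_mul, hL, Matrix.of_apply, Matrix.submatrix_apply,
      taylorMatrix]
    rw [Fin.val_last, eval_logDerivOp_of_lt _ i.is_lt, mul_zero, add_zero, mul_sum]
    refine sum_congr rfl fun d _ => ?_
    rw [Fin.val_castSucc]
    ring
  have h := congrArg Matrix.det hmul
  rw [Matrix.det_mul, hdetL, det_taylorMatrix_submatrix] at h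
  rw [prod_range_succ]
  refine h.trans ?_
  ring

/-- The monic polynomial proportional to the truncated exponential evaluated at `-X`. -/
noncomputable def monicTruncExp (d : ℕ) : ℝ[X] :=
  ∑ l ∈ range (d + 1), C ((-1 : ℝ) ^ d * d.factorial * ((-1) ^ l / l.factorial)) * X ^ l

lemma coeff_monicTruncExp_self (d : ℕ) : (monicTruncExp d).coeff d = 1 := by
  have h : (d.factorial : ℝ) ≠ 0 := by positivity
  have e : (-1 : ℝ) ^ d * (-1) ^ d = 1 := by rw [← mul_pow]; simp
  simp only [monicTruncExp, finsetSum_coeff, coeff_C_mul, coeff_X_pow, mul_ite, mul_one, mul_zero,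
    sum_ite_eq, mem_range, Nat.lt_succ_self, if_true]
  field_simp
  linear_combination e

lemma natDegree_monicTruncExp (d : ℕ) : (monicTruncExp d).natDegree = d := by
  refine le_antisymm ?_ (le_natDegree_of_ne_zero (by simp [coeff_monicTruncExp_self]))
  refine natDegree_sum_le_of_forall_le _ _ fun l hl => ?_
  exact (natDegree_C_mul_X_pow_le _ _).trans (Nat.lt_succ_iff.mp (mem_range.mp hl))

lemma monic_monicTruncExp (d : ℕ) : (monicTruncExp d).Monic := by
  rw [Monic, leadingCoeff, natDegree_monicTruncExp, coeff_monicTruncExp_self]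

lemma truncExp_eq (d : ℕ) (s : ℝ) :
    truncExp d s = (-1 : ℝ) ^ d * (d.factorial : ℝ)⁻¹ * (monicTruncExp d).eval (-s) := by
  have h : (d.factorial : ℝ) ≠ 0 := by positivity
  have e : (-1 : ℝ) ^ d * (-1) ^ d = 1 := by rw [← mul_pow]; simp
  simp only [monicTruncExp, truncExp, eval_finsetSum, eval_mul, eval_C, eval_pow, eval_X, mul_sum]
  refine sum_congr rfl fun l _ => ?_
  have el : (-1 : ℝ) ^ l * (-1) ^ l = 1 := by rw [← mul_pow]; simp
  rw [neg_pow s]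
  field_simp
  linear_combination (-s ^ l) * el - s ^ l * ((-1) ^ l) ^ 2 * e

lemma det_eval_monicTruncExp_rev {n : ℕ} (s : Fin n → ℝ) :
    (Matrix.of fun i j : Fin n => (monicTruncExp (j.rev : ℕ)).eval (-s i)).det
      = ∏ p ∈ univ.filter (fun p : Fin n × Fin n => p.1 < p.2), (s p.2 - s p.1) := by
  have h := Matrix.det_eval_matrixOfPolynomials_eq_det_vandermonde (fun i => -s i)
    (fun d : Fin n => monicTruncExp d) (fun d => natDegree_monicTruncExp d)
    (fun d => monic_monicTruncExp d)
  have h1 := Matrix.det_permute' Fin.revPerm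
    (Matrix.of fun i j : Fin n => (monicTruncExp (j : ℕ)).eval (-s i))
  have h2 := Matrix.det_permute' Fin.revPerm (Matrix.vandermonde fun i => -s i)
  have h3 : (Matrix.vandermonde fun i => -s i).submatrix id Fin.revPerm
      = Matrix.projVandermonde 1 (fun i => -s i) := by
    ext i j
    simp [Matrix.projVandermonde_apply, Matrix.vandermonde_apply]
  rw [← h, ← h2, h3, Matrix.det_projVandermonde] at h1
  refine h1.trans ?_
  rw [prod_filter, Fintype.prod_prod_type]
  refine prod_congr rfl fun i _ => ?_
  rw [← prod_filter, filter_lt_eq_Ioi]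
  refine prod_congr rfl fun j _ => ?_
  simp only [Pi.one_apply]
  ring

lemma det_signed_Wkn (N : ℕ) (hN : 1 ≤ N) (a : Fin (N + 1) → ℝ) (ha : ∀ i, 0 < a i) :
    (Matrix.of fun i j : Fin (N + 1) =>
        (-1 : ℝ) ^ ((j : ℕ) + 1 + 1) * Wkn (N + 1) ((j : ℕ) + 1) (a i)).det =
      (∏ r ∈ range (N + 1), (r.factorial : ℝ)) ^ (N - 1) *
        (∏ p ∈ univ.filter (fun p : Fin (N + 1) × Fin (N + 1) => p.1 < p.2),
          (log (a p.2) - log (a p.1))) /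
        ∏ j : Fin (N + 1), (a j) ^ (N * (N - 1) / 2) := by
  set K : ℝ := ∏ r ∈ range (N + 1), (r.factorial : ℝ) with hK
  have hK0 : K ≠ 0 := prod_ne_zero_iff.mpr fun r _ => by positivity
  have hM : (Matrix.of fun i j : Fin (N + 1) =>
        (-1 : ℝ) ^ ((j : ℕ) + 1 + 1) * Wkn (N + 1) ((j : ℕ) + 1) (a i))
      = Matrix.of fun i j => (a i ^ (N * (N - 1) / 2))⁻¹ *
          Matrix.of (fun i j : Fin (N + 1) =>
            (K * (-1) ^ N * ((j : ℕ).factorial : ℝ)⁻¹ * ((j.rev : ℕ).factorial : ℝ)⁻¹) *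
            Matrix.of (fun i j : Fin (N + 1) =>
              (monicTruncExp (j.rev : ℕ)).eval (-log (a i))) i j) i j := by
    ext i j
    have hj : N - (j : ℕ) = (j.rev : ℕ) := by rw [Fin.val_rev]; omega
    have e : (-1 : ℝ) ^ N = (-1) ^ (j : ℕ) * (-1) ^ (j.rev : ℕ) := by
      rw [← pow_add]
      congr 1
      omega
    simp only [Matrix.of_apply]
    rw [Wkn_succ N j (ha i), truncExp_eq, hj, e, ← hK]
    ring
  have hid : ∏ j : Fin (N + 1), ((j : ℕ).factorial : ℝ)⁻¹ = K⁻¹ := by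
    rw [prod_inv_distrib, hK, Finset.prod_range]
  have hrev : ∏ j : Fin (N + 1), ((j.rev : ℕ).factorial : ℝ)⁻¹ = K⁻¹ :=
    (Equiv.prod_comp Fin.revPerm (fun j : Fin (N + 1) => ((j : ℕ).factorial : ℝ)⁻¹)).trans hid
  have hsign : ((-1 : ℝ) ^ N) ^ (N + 1) = 1 := by
    rw [← pow_mul]
    exact (Nat.even_mul_succ_self N).neg_one_pow
  rw [hM, Matrix.det_mul_column, Matrix.det_mul_row, det_eval_monicTruncExp_rev]
  simp only [prod_mul_distrib, hrev, hid, prod_const, card_univ, Fintype.card_fin, hsign,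
    prod_inv_distrib]
  obtain ⟨M, rfl⟩ := Nat.exists_eq_add_of_le' hN
  rw [Nat.add_sub_cancel, div_eq_mul_inv]
  field_simp
  ring

end LogWronskian

theorem stmt_15 (n : ℕ) (hn : 3 ≤ n) (a : Fin n → ℝ)
    (ha0 : ∀ i, 0 < a i) (hmono : StrictMono a) :
    (Matrix.of fun i j : Fin n => (-1 : ℝ) ^ ((j : ℕ) + 1 + 1) * Wkn n ((j : ℕ) + 1) (a i)).det =
      (∏ r ∈ Finset.range n, (Nat.factorial r : ℝ)) ^ (n - 2) *
        (∏ p ∈ Finset.univ.filter (fun p : Fin n × Fin n => p.1 < p.2),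
          (Real.log (a p.2) - Real.log (a p.1))) /
        ∏ j : Fin n, (a j) ^ ((n - 1) * (n - 2) / 2) := by
  obtain ⟨N, rfl⟩ := Nat.exists_eq_add_of_le' (show 1 ≤ n by omega)
  exact LogWronskian.det_signed_Wkn N (by omega) a ha0
end

section
/- For integers n ≥ 3 and real numbers 0 < a_1 < a_2 < ... < a_n, let k_n(t) = (Π_{r=0}^{n-1} r!) / t^{n(n-3)/2}. Then the determinant of the n×n matrix whose first column has entries k_n(a_i) and whose (i,j) entry for j ≥ 2 is (-1)^{j+1}·W_{j,n}(a_i) equals (-1)^{n-1} · (n-1)! · (Π_{r=0}^{n-1} r!)^{n-2} · [ Σ_{i=1}^{n} (-1)^{i+1} a_i · Π_{1 ≤ j < k ≤ n, j ≠ i, k ≠ i} (log a_k − log a_j) ] / [ Π_{j=1}^{n} a_j^{(n-1)(n-2)/2} ]. -/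
open Real Finset

/-- `kfun n t = (∏_{r=0}^{n-1} r!) / t^{n(n-3)/2}`. -/
noncomputable def kfun (n : ℕ) (t : ℝ) : ℝ :=
  (∏ r ∈ Finset.range n, (Nat.factorial r : ℝ)) / t ^ (n * (n - 3) / 2)

open Polynomial in
/-- `logDerivPoly i P` is the polynomial `Q` such that the `i`-th derivative of `P (log t)` is
`t⁻¹ ^ i * Q (log t)`. -/
noncomputable def logDerivPoly : ℕ → ℝ[X] →ₗ[ℝ] ℝ[X]
  | 0 => LinearMap.id
  | i + 1 => (derivative - (i : ℝ) • LinearMap.id) ∘ₗ logDerivPoly i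

open Polynomial in
/-- `appellPoly k` solves `Q - Q' = X ^ k`. -/
noncomputable def appellPoly : ℕ → ℝ[X]
  | 0 => 1
  | k + 1 => X ^ (k + 1) + C ((k : ℝ) + 1) * appellPoly k

section

open Polynomial

lemma iteratedDeriv_of_eq_eval_log {f : ℝ → ℝ} {P : ℝ[X]}
    (hf : ∀ u, 0 < u → f u = P.eval (log u)) (i : ℕ) :
    ∀ u, 0 < u → iteratedDeriv i f u = u⁻¹ ^ i * (logDerivPoly i P).eval (log u) := by
  induction i with
  | zero => intro u hu; simp [logDerivPoly, hf u hu]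
  | succ i ih =>
    intro u hu
    have hev : iteratedDeriv i f =ᶠ[nhds u]
        fun u => u⁻¹ ^ i * (logDerivPoly i P).eval (log u) := by
      filter_upwards [lt_mem_nhds hu] with v hv using ih v hv
    rw [iteratedDeriv_succ, hev.deriv_eq]
    have h1 := ((hasDerivAt_inv hu.ne').pow i).mul
      (((logDerivPoly i P).hasDerivAt (log u)).comp u (hasDerivAt_log hu.ne'))
    refine (h1.congr_of_eventuallyEq ?_).deriv.trans ?_
    · exact Filter.EventuallyEq.of_eq (by ext; simp)
    · simp only [logDerivPoly, LinearMap.comp_apply, LinearMap.sub_apply, LinearMap.smul_apply,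
        LinearMap.id_apply, eval_sub, eval_smul, smul_eq_mul, Function.comp, Pi.pow_apply,
        ← inv_pow]
      rcases i with _ | i
      · simp; ring
      · simp only [Nat.add_sub_cancel]
        ring

lemma logDerivPoly_X_sub_C_pow (s : ℝ) (i k : ℕ) :
    ∃ R : ℝ[X], logDerivPoly i ((X - C s) ^ (i + k)) = (X - C s) ^ k * R ∧
      R.eval s = ((i + k).descFactorial i : ℝ) := by
  induction i generalizing k with
  | zero => exact ⟨1, by simp [logDerivPoly]⟩
  | succ i ih =>
    obtain ⟨R, hR, hRs⟩ := ih (k + 1)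
    refine ⟨C ((k : ℝ) + 1) * R + (X - C s) * (derivative R - C (i : ℝ) * R), ?_, ?_⟩
    · rw [show i + 1 + k = i + (k + 1) by ring, logDerivPoly, LinearMap.comp_apply, hR]
      simp only [LinearMap.sub_apply, LinearMap.smul_apply, LinearMap.id_apply, derivative_mul,
        derivative_X_sub_C_pow, smul_eq_C_mul, Nat.add_sub_cancel]
      push_cast
      simp only [map_add, map_one, map_natCast]
      ring
    · simp only [eval_add, eval_mul, eval_sub, eval_X, eval_C, hRs, sub_self, zero_mul, add_zero]
      rw [show i + 1 + k = i + (k + 1) by ring, Nat.descFactorial_succ]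
      push_cast
      rw [show i + (k + 1) - i = k + 1 by omega]
      push_cast
      ring

lemma eval_logDerivPoly_of_lt (s : ℝ) {i m : ℕ} (h : i < m) :
    (logDerivPoly i ((X - C s) ^ m)).eval s = 0 := by
  obtain ⟨k, rfl⟩ := Nat.exists_eq_add_of_lt h
  obtain ⟨R, hR, -⟩ := logDerivPoly_X_sub_C_pow s i (k + 1)
  rw [add_assoc, hR]
  simp

lemma eval_logDerivPoly_self (s : ℝ) (m : ℕ) :
    (logDerivPoly m ((X - C s) ^ m)).eval s = (m.factorial : ℝ) := by
  obtain ⟨R, hR, hRs⟩ := logDerivPoly_X_sub_C_pow s m 0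
  rw [add_zero] at hR hRs
  rw [hR]
  simp [hRs, Nat.descFactorial_self]

lemma appellPoly_monic_natDegree (k : ℕ) :
    (appellPoly k).Monic ∧ (appellPoly k).natDegree = k := by
  induction k with
  | zero => simp [appellPoly]
  | succ k ih =>
    have hlt : (C ((k : ℝ) + 1) * appellPoly k).natDegree < k + 1 :=
      (natDegree_C_mul_le _ _).trans_lt (by omega)
    have hlt' : (C ((k : ℝ) + 1) * appellPoly k).degree < ((k + 1 : ℕ) : WithBot ℕ) :=
      degree_le_natDegree.trans_lt (by exact_mod_cast hlt)
    have hdeg : (appellPoly (k + 1)).degree = ((k + 1 : ℕ) : WithBot ℕ) := by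
      rw [appellPoly, degree_add_eq_left_of_degree_lt] <;> rw [degree_X_pow]
      exact hlt'
    exact ⟨monic_X_pow_add hlt', natDegree_eq_of_degree_eq_some hdeg⟩

/-- The function `deriv (xfun (m + 1))` as a polynomial in `log`. -/
noncomputable def derivXfunPoly (m : ℕ) : ℝ[X] := X ^ m + C (m : ℝ) * X ^ (m - 1)

lemma deriv_xfun_eq (m : ℕ) (u : ℝ) (hu : 0 < u) :
    deriv (xfun (m + 1)) u = (derivXfunPoly m).eval (log u) := by
  have h := (hasDerivAt_id u).mul ((hasDerivAt_log hu.ne').pow m)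
  refine (h.congr_of_eventuallyEq (f₁ := xfun (m + 1)) ?_).deriv.trans ?_
  · exact Filter.EventuallyEq.of_eq (by ext; simp [xfun])
  · simp [derivXfunPoly]
    field_simp

/-- The coefficients of the solution `P` of `P + P' = (X - s) ^ m`. -/
noncomputable def appellCoeff (s : ℝ) (m l : ℕ) : ℝ :=
  (m.choose l : ℝ) * ((-1) ^ (m - l) * (appellPoly (m - l)).eval s)

lemma sum_appellCoeff (s : ℝ) {m n : ℕ} (h : m < n) :
    ∑ l ∈ range n, appellCoeff s m l • derivXfunPoly l = (X - C s) ^ m := by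
  ext k
  rw [sub_eq_add_neg X, ← C_neg, coeff_X_add_C_pow, finsetSum_coeff]
  have hterm : ∀ l, (appellCoeff s m l • derivXfunPoly l).coeff k =
      (if l = k then appellCoeff s m l else 0) +
        (if l = k + 1 then appellCoeff s m l * l else 0) := by
    intro l
    rw [coeff_smul, derivXfunPoly, coeff_add, coeff_C_mul, coeff_X_pow, coeff_X_pow, smul_eq_mul]
    rcases l with _ | l
    · by_cases hk : k = 0
      · simp [hk]
      · simp [hk, Ne.symm hk]
    · by_cases h1 : k = l + 1 <;> by_cases h2 : k = l <;>
        simp [h1, h2, eq_comm]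
  simp only [hterm, sum_add_distrib, sum_ite_eq', mem_range]
  have hz : ∀ l, ¬ l < n → appellCoeff s m l = 0 := fun l hl => by
    simp [appellCoeff, Nat.choose_eq_zero_of_lt (show m < l by omega)]
  rw [ite_eq_left_iff.2 fun hl => (hz k hl).symm,
    ite_eq_left_iff.2 fun hl => by rw [hz _ hl, zero_mul]]
  rcases lt_trichotomy m k with hk | rfl | hk
  · simp [appellCoeff, Nat.choose_eq_zero_of_lt hk,
      Nat.choose_eq_zero_of_lt (show m < k + 1 by omega)]
  · simp [appellCoeff, appellPoly]
  · obtain ⟨d, rfl⟩ := Nat.exists_eq_add_of_lt hk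
    have hc : ((k + d + 1).choose (k + 1) : ℝ) * ((k : ℝ) + 1) =
        ((k + d + 1).choose k : ℝ) * ((d : ℝ) + 1) := by
      have := Nat.choose_succ_right_eq (k + d + 1) k
      rw [show k + d + 1 - k = d + 1 by omega] at this
      exact_mod_cast this
    simp only [appellCoeff]
    rw [show k + d + 1 - k = d + 1 by omega, show k + d + 1 - (k + 1) = d by omega]
    simp only [appellPoly, eval_add, eval_mul, eval_pow, eval_X, eval_C]
    push_cast
    rw [neg_pow s (d + 1), pow_succ (-1 : ℝ) d]
    linear_combination ((-1) ^ d * (appellPoly d).eval s) * hc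

end

/-- The full Wronskian matrix of `x_1', …, x_n'`. -/
noncomputable def wronskianMatrix (n : ℕ) (t : ℝ) : Matrix (Fin n) (Fin n) ℝ :=
  Matrix.of fun i m => iteratedDeriv (i : ℕ) (deriv (xfun ((m : ℕ) + 1))) t

lemma wronskianMatrix_mul (n : ℕ) {t : ℝ} (ht : 0 < t) (i m : Fin n) :
    (wronskianMatrix n t * Matrix.of fun l m : Fin n => appellCoeff (log t) m l) i m =
      t⁻¹ ^ (i : ℕ) * (logDerivPoly i ((Polynomial.X - Polynomial.C (log t)) ^ (m : ℕ))).eval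
        (log t) := by
  rw [← sum_appellCoeff (log t) m.isLt, Matrix.mul_apply, map_sum, Polynomial.eval_finsetSum,
    Finset.mul_sum, Finset.sum_range]
  refine Finset.sum_congr rfl fun l _ => ?_
  simp only [wronskianMatrix, Matrix.of_apply]
  rw [iteratedDeriv_of_eq_eval_log (fun u hu => deriv_xfun_eq l u hu) i t ht, map_smul,
    Polynomial.eval_smul, smul_eq_mul]
  ring

lemma det_wronskianMatrix (n : ℕ) {t : ℝ} (ht : 0 < t) :
    (wronskianMatrix n t).det =
      (∏ r ∈ range n, (Nat.factorial r : ℝ)) * t⁻¹ ^ (∑ r ∈ range n, r) := by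
  have hU : (Matrix.of fun l m : Fin n => appellCoeff (log t) m l).det = 1 := by
    rw [Matrix.det_of_isUpperTriangular]
    · simp [appellCoeff, appellPoly]
    · intro i j hij
      simp only [id] at hij
      simp [appellCoeff, Nat.choose_eq_zero_of_lt (show (j : ℕ) < i from hij)]
  have hB := Matrix.det_mul (wronskianMatrix n t)
    (Matrix.of fun l m : Fin n => appellCoeff (log t) m l)
  rw [hU, mul_one] at hB
  rw [← hB, Matrix.det_of_isLowerTriangular]
  · simp only [wronskianMatrix_mul n ht, eval_logDerivPoly_self]
    rw [prod_mul_distrib, Finset.prod_range, ← Finset.prod_pow_eq_pow_sum, Finset.prod_range,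
      mul_comm]
  · intro i j hij
    rw [wronskianMatrix_mul n ht, eval_logDerivPoly_of_lt, mul_zero]
    exact hij

lemma Wkn_eq_det_submatrix (N : ℕ) (j : Fin (N + 1)) (t : ℝ) :
    Wkn (N + 1) ((j : ℕ) + 1) t =
      ((wronskianMatrix (N + 1) t).submatrix (Fin.last N).succAbove j.succAbove).det := by
  unfold Wkn
  congr 1
  ext i m
  simp only [Matrix.of_apply, Matrix.submatrix_apply, wronskianMatrix, Fin.succAbove_last,
    Fin.val_castSucc, Fin.succAbove, Fin.lt_def]
  congr 2
  have h1 : (m : ℕ) + 1 < (j : ℕ) + 1 ↔ (m : ℕ) < j := by omega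
  simp only [h1]
  split_ifs <;> simp

lemma Wkn_eq (N : ℕ) (j : Fin (N + 1)) {t : ℝ} (ht : 0 < t) :
    Wkn (N + 1) ((j : ℕ) + 1) t = (∏ r ∈ range N, (Nat.factorial r : ℝ)) *
      t⁻¹ ^ (∑ r ∈ range N, r) * ((N.choose j : ℝ) * (appellPoly (N - j)).eval (log t)) := by
  set A := wronskianMatrix (N + 1) t with hA
  set U : Matrix (Fin (N + 1)) (Fin (N + 1)) ℝ :=
    Matrix.of fun l m => appellCoeff (log t) m l with hU
  have h1 : (A.adjugate * (A * U)) j (Fin.last N) = A.det * U j (Fin.last N) := by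
    rw [← Matrix.mul_assoc, Matrix.adjugate_mul, Matrix.smul_mul, Matrix.one_mul,
      Matrix.smul_apply, smul_eq_mul]
  rw [Matrix.mul_apply, Fin.sum_univ_castSucc, Finset.sum_eq_zero, zero_add,
    wronskianMatrix_mul _ ht, Fin.val_last, eval_logDerivPoly_self,
    Matrix.adjugate_fin_succ_eq_det_submatrix, ← Wkn_eq_det_submatrix, det_wronskianMatrix _ ht,
    prod_range_succ, sum_range_succ, pow_add, hU, Matrix.of_apply, appellCoeff, Fin.val_last] at h1
  · have hsgn : (-1 : ℝ) ^ (N - (j : ℕ)) = (-1) ^ (N + (j : ℕ)) := by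
      rw [show N + (j : ℕ) = (N - j) + 2 * j by omega, pow_add, pow_mul]
      simp
    have hs2 : (-1 : ℝ) ^ (N + (j : ℕ)) * (-1) ^ (N + (j : ℕ)) = 1 := by
      rw [← mul_pow]; simp
    rw [hsgn] at h1
    have hne : t⁻¹ ^ N * (Nat.factorial N : ℝ) ≠ 0 := by positivity
    apply mul_right_cancel₀ hne
    linear_combination (-1 : ℝ) ^ (N + (j : ℕ)) * h1 -
      (Wkn (N + 1) (j + 1) t * (t⁻¹ ^ N * (Nat.factorial N : ℝ)) -
      (∏ r ∈ range N, (Nat.factorial r : ℝ)) *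
      t⁻¹ ^ (∑ r ∈ range N, r) * ((N.choose j : ℝ) * (appellPoly (N - j)).eval (log t)) *
      (t⁻¹ ^ N * (Nat.factorial N : ℝ))) * hs2
  · intro i _
    rw [wronskianMatrix_mul _ ht, eval_logDerivPoly_of_lt, mul_zero, mul_zero]
    exact i.isLt

lemma sign_revPerm (N : ℕ) :
    ((Equiv.Perm.sign (Fin.revPerm (n := N)) : ℤ) : ℝ) = ∏ i : Fin N, (-1 : ℝ) ^ (N - 1 - i : ℕ) := by
  rw [Equiv.Perm.sign_eq_prod_prod_Ioi]
  push_cast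
  refine Finset.prod_congr rfl fun i _ => ?_
  rw [Finset.prod_congr rfl (g := fun _ => (-1 : ℝ)), Finset.prod_const, Fin.card_Ioi]
  intro k hk
  rw [Finset.mem_Ioi] at hk
  simp [hk.not_gt]

lemma det_appellPoly_rev (N : ℕ) (s : Fin N → ℝ) :
    (Matrix.of fun i j : Fin N => (appellPoly (N - (j + 1))).eval (s i)).det =
      (∏ i : Fin N, (-1 : ℝ) ^ (N - 1 - i : ℕ)) * ∏ i : Fin N, ∏ j ∈ Ioi i, (s j - s i) := by
  rw [← Matrix.det_vandermonde, Matrix.det_eval_matrixOfPolynomials_eq_det_vandermonde s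
    (fun j => appellPoly j) (fun j => (appellPoly_monic_natDegree j).2)
    (fun j => (appellPoly_monic_natDegree j).1), ← sign_revPerm, ← Matrix.det_permute']
  congr 1

lemma prod_pairs_succAbove (N : ℕ) (s : Fin (N + 1) → ℝ) (i : Fin (N + 1)) :
    ∏ p : Fin N, ∏ q ∈ Ioi p, (s (i.succAbove q) - s (i.succAbove p)) =
      ∏ p ∈ univ.filter (fun p : Fin (N + 1) × Fin (N + 1) => p.1 < p.2 ∧ p.1 ≠ i ∧ p.2 ≠ i),
        (s p.2 - s p.1) := by
  rw [Finset.prod_sigma']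
  refine Finset.prod_bij (fun p _ => (i.succAbove p.1, i.succAbove p.2)) ?_ ?_ ?_ ?_
  · rintro ⟨p, q⟩ h
    simp only [mem_sigma, mem_univ, true_and, mem_Ioi] at h
    simp [Fin.succAbove_ne, h]
  · rintro ⟨p, q⟩ _ ⟨p', q'⟩ _ h
    simpa using h
  · rintro ⟨p, q⟩ h
    simp only [mem_filter, mem_univ, true_and] at h
    obtain ⟨p, rfl⟩ := Fin.exists_succAbove_eq h.2.1
    obtain ⟨q, rfl⟩ := Fin.exists_succAbove_eq h.2.2
    exact ⟨⟨p, q⟩, by simpa using h.1, rfl⟩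
  · intros; rfl

lemma prod_choose_mul_sq (N : ℕ) :
    (∏ l ∈ range (N + 1), (N.choose l : ℝ)) * (∏ r ∈ range (N + 1), (Nat.factorial r : ℝ)) ^ 2 =
      (Nat.factorial N : ℝ) ^ (N + 1) := by
  rw [sq]
  nth_rewrite 3 [← Finset.prod_range_reflect]
  rw [← prod_mul_distrib, ← prod_mul_distrib, ← card_range (N + 1), ← prod_const, card_range]
  refine Finset.prod_congr rfl fun l hl => ?_
  rw [mem_range] at hl
  rw [Nat.add_sub_cancel, ← mul_assoc]
  exact_mod_cast Nat.choose_mul_factorial_mul_factorial (show l ≤ N by omega)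

theorem stmt_16 (n : ℕ) (hn : 3 ≤ n) (a : Fin n → ℝ)
    (ha0 : ∀ i, 0 < a i) (hmono : StrictMono a) :
    (Matrix.of fun i j : Fin n =>
        if (j : ℕ) = 0 then kfun n (a i)
        else (-1 : ℝ) ^ ((j : ℕ) + 1 + 1) * Wkn n ((j : ℕ) + 1) (a i)).det =
      (-1 : ℝ) ^ (n - 1) * (Nat.factorial (n - 1) : ℝ) *
        (∏ r ∈ Finset.range n, (Nat.factorial r : ℝ)) ^ (n - 2) *
        (∑ i : Fin n, (-1 : ℝ) ^ ((i : ℕ) + 1 + 1) * a i *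
          ∏ p ∈ Finset.univ.filter (fun p : Fin n × Fin n => p.1 < p.2 ∧ p.1 ≠ i ∧ p.2 ≠ i),
            (Real.log (a p.2) - Real.log (a p.1))) /
        ∏ j : Fin n, (a j) ^ ((n - 1) * (n - 2) / 2) := by
  obtain ⟨N, rfl⟩ : ∃ N, n = N + 1 := ⟨n - 1, by omega⟩
  set K : ℝ := ∏ r ∈ range N, (Nat.factorial r : ℝ) with hK
  set e : ℕ := ∑ r ∈ range N, r with he
  have he' : e = N * (N - 1) / 2 := Finset.sum_range_id N
  have hk : ∀ t : ℝ, 0 < t → kfun (N + 1) t = t⁻¹ ^ e * (K * (Nat.factorial N : ℝ) * t) := by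
    intro t ht
    have hexp : e = (N + 1) * (N + 1 - 3) / 2 + 1 := by
      obtain ⟨M, rfl⟩ : ∃ M, N = M + 2 := ⟨N - 2, by omega⟩
      rw [he', show (M + 2) * (M + 2 - 1) = (M + 2 + 1) * (M + 2 + 1 - 3) + 1 * 2 by
        rw [show M + 2 - 1 = M + 1 by omega, show M + 2 + 1 - 3 = M by omega]; ring,
        Nat.add_mul_div_right _ _ (by norm_num)]
    rw [kfun, prod_range_succ, hexp, ← hK, div_eq_mul_inv, ← inv_pow]
    linear_combination (-(t⁻¹ ^ ((N + 1) * (N + 1 - 3) / 2) * K * (Nat.factorial N : ℝ))) *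
      inv_mul_cancel₀ ht.ne'
  set d : Fin (N + 1) → ℝ := Fin.cons (K * (Nat.factorial N : ℝ))
    (fun j : Fin N => (-1) ^ ((j : ℕ) + 1) * K * (N.choose ((j : ℕ) + 1) : ℝ)) with hd
  set G : Matrix (Fin (N + 1)) (Fin (N + 1)) ℝ := Matrix.of fun i j =>
    (Fin.cons (a i) (fun j : Fin N => (appellPoly (N - (j + 1))).eval (log (a i))) :
      Fin (N + 1) → ℝ) j with hG
  have hM : (Matrix.of fun i j : Fin (N + 1) =>
        if (j : ℕ) = 0 then kfun (N + 1) (a i)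
        else (-1 : ℝ) ^ ((j : ℕ) + 1 + 1) * Wkn (N + 1) ((j : ℕ) + 1) (a i)) =
      Matrix.of fun i j => (a i)⁻¹ ^ e * (Matrix.of fun i j => d j * G i j) i j := by
    ext i j
    refine Fin.cases ?_ (fun j => ?_) j
    · simp [hd, hG, hk _ (ha0 i)]
    · simp only [Matrix.of_apply]
      rw [Wkn_eq N j.succ (ha0 i)]
      simp only [Fin.val_succ, hd, hG, Fin.cons_succ, Matrix.of_apply, ← hK, ← he]
      rw [if_neg (by omega)]
      ring
  have hGdet : G.det = (∏ i : Fin N, (-1 : ℝ) ^ (N - 1 - i : ℕ)) *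
      ∑ i : Fin (N + 1), (-1 : ℝ) ^ ((i : ℕ) + 1 + 1) * a i *
        ∏ p ∈ univ.filter (fun p : Fin (N + 1) × Fin (N + 1) => p.1 < p.2 ∧ p.1 ≠ i ∧ p.2 ≠ i),
          (log (a p.2) - log (a p.1)) := by
    rw [Matrix.det_succ_column_zero, Finset.mul_sum]
    refine Finset.sum_congr rfl fun i _ => ?_
    have := det_appellPoly_rev N (fun p => log (a (i.succAbove p)))
    rw [prod_pairs_succAbove N (fun p => log (a p)) i] at this
    rw [show G.submatrix i.succAbove Fin.succ = Matrix.of fun p j : Fin N =>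
      (appellPoly (N - (j + 1))).eval (log (a (i.succAbove p))) from rfl, this]
    simp only [hG, Matrix.of_apply, Fin.cons_zero]
    ring
  have hsgn : (∏ j : Fin N, (-1 : ℝ) ^ ((j : ℕ) + 1)) * ∏ i : Fin N, (-1 : ℝ) ^ (N - 1 - i : ℕ) =
      (-1) ^ N := by
    rw [← prod_mul_distrib, Finset.prod_congr rfl (g := fun _ => (-1 : ℝ) ^ N)]
    · rw [prod_const, card_univ, Fintype.card_fin, ← pow_mul]
      rcases Nat.even_or_odd N with h | h
      · rw [h.neg_one_pow, (h.mul_left N).neg_one_pow]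
      · rw [h.neg_one_pow, (h.mul h).neg_one_pow]
    · intro i _
      rw [← pow_add]
      congr 1
      omega
  have hdprod : ∏ j, d j = (∏ j : Fin N, (-1 : ℝ) ^ ((j : ℕ) + 1)) *
      ((Nat.factorial N : ℝ) * (K * (Nat.factorial N : ℝ)) ^ (N - 1)) := by
    have hc := prod_choose_mul_sq N
    rw [prod_range_succ (fun r => (Nat.factorial r : ℝ)), prod_range_succ', Nat.choose_zero_right,
      Nat.cast_one, mul_one, prod_range] at hc
    have hK0 : 0 < K := prod_pos fun r _ => by positivity
    have hf0 : (0 : ℝ) < Nat.factorial N := by positivity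
    rw [Fin.prod_univ_succ]
    simp only [hd, Fin.cons_zero, Fin.cons_succ, prod_mul_distrib, prod_const, card_univ,
      Fintype.card_fin]
    obtain ⟨M, rfl⟩ : ∃ M, N = M + 1 := ⟨N - 1, by omega⟩
    rw [Nat.add_sub_cancel]
    apply mul_right_cancel₀ (mul_pos hK0 hf0).ne'
    simp only [mul_pow, pow_succ] at hc ⊢
    linear_combination (∏ j : Fin (M + 1), ((-1 : ℝ) ^ (j : ℕ) * -1)) * K ^ M * K * hc
  rw [hM, Matrix.det_mul_column, Matrix.det_mul_row, hGdet, hdprod, prod_range_succ, ← hK,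
    Nat.add_sub_cancel, show N + 1 - 2 = N - 1 by omega, ← he', ← hsgn, div_eq_mul_inv,
    ← Finset.prod_inv_distrib]
  simp only [inv_pow]
  ring
end

section
/- Let n ≥ 3 be an integer and let 0 < a_1 < a_2 < ... < a_n be real numbers. Consider the n×n linear system A·x = b, where A is the matrix with (i,j) entry (-1)^{j+1}·W_{j,n}(a_i) and b is the vector with entries k_n(a_i) = (Π_{r=0}^{n-1} r!) / a_i^{n(n-3)/2}. (This system expresses the simultaneous intersection of the osculating hyperplanes to the curve α(t) = (t, t log t, ..., t(log t)^{n-1}) at the parameters a_1,...,a_n.) Then A is invertible, so the system has a unique solution (x_1, ..., x_n), and its first coordinate satisfies x_1 = (n-1)! · Σ_{j=1}^{n} a_j / Π_{i=1, i≠j}^{n} (log a_j − log a_i), i.e., x_1 equals Neuman's logarithmic mean L_N(a_1, ..., a_n). -/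
open Real Finset

open Polynomial in
theorem exists_iteratedDeriv_log_sub_pow (u : ℝ) (r m : ℕ) :
    ∃ g : ℝ[X], ∀ s : ℝ, 0 < s →
      iteratedDeriv r (fun s => (Real.log s - u) ^ (m + r)) s =
        (s ^ r)⁻¹ * (C ((m + r).descFactorial r : ℝ) * X ^ m + X ^ (m + 1) * g).eval
          (Real.log s - u) := by
  induction r generalizing m with
  | zero => exact ⟨0, fun s _ => by simp⟩
  | succ r ih =>
    obtain ⟨g, hg⟩ := ih (m + 1)
    set c : ℝ := ((m + 1 + r).descFactorial r : ℝ) with hc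
    refine ⟨-C (r : ℝ) * (C c + X * g) + (C (m : ℝ) + 2) * g + X * derivative g, fun s hs => ?_⟩
    have hk : m + (r + 1) = m + 1 + r := by ring
    have hdesc : ((m + 1 + r).descFactorial (r + 1) : ℝ) = (m + 1) * c := by
      rw [Nat.descFactorial_succ, Nat.add_sub_cancel]
      push_cast
      rfl
    rw [hk, hdesc, iteratedDeriv_succ]
    have hev : iteratedDeriv r (fun s => (Real.log s - u) ^ (m + 1 + r)) =ᶠ[nhds s]
        fun s => (s ^ r)⁻¹ * (C c * X ^ (m + 1) + X ^ (m + 1 + 1) * g).eval (Real.log s - u) := by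
      filter_upwards [lt_mem_nhds hs] with y hy
      exact hg y hy
    rw [hev.deriv_eq]
    have h1 : HasDerivAt (fun s : ℝ => Real.log s - u) s⁻¹ s :=
      (Real.hasDerivAt_log hs.ne').sub_const u
    have h2 := ((C c * X ^ (m + 1) + X ^ (m + 1 + 1) * g).hasDerivAt (Real.log s - u)).comp s h1
    have h3 := ((hasDerivAt_pow r s).inv (pow_ne_zero r hs.ne')).mul h2
    refine h3.deriv.trans ?_
    have hr : (r : ℝ) * s ^ (r - 1) = r * s ^ r * s⁻¹ := by
      rcases r with _ | r
      · simp
      · rw [Nat.add_sub_cancel, pow_succ]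
        field_simp
    simp only [Function.comp, hr, derivative_add, derivative_mul, derivative_C, derivative_X_pow,
      eval_add, eval_mul, eval_pow, eval_X, eval_C, eval_neg, eval_ofNat, eval_zero,
      Nat.add_sub_cancel, Pi.inv_apply]
    have : s ≠ 0 := hs.ne'
    push_cast
    field_simp
    ring

theorem iteratedDeriv_log_sub_pow_of_lt {t : ℝ} (ht : 0 < t) {r k : ℕ} (h : r < k) :
    iteratedDeriv r (fun s => (Real.log s - Real.log t) ^ k) t = 0 := by
  obtain ⟨m, rfl⟩ := Nat.exists_eq_add_of_lt h
  obtain ⟨g, hg⟩ := exists_iteratedDeriv_log_sub_pow (Real.log t) r (m + 1)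
  rw [show r + m + 1 = m + 1 + r by ring, hg t ht]
  simp

theorem iteratedDeriv_log_sub_pow_self {t : ℝ} (ht : 0 < t) (r : ℕ) :
    iteratedDeriv r (fun s => (Real.log s - Real.log t) ^ r) t = r.factorial / t ^ r := by
  obtain ⟨g, hg⟩ := exists_iteratedDeriv_log_sub_pow (Real.log t) r 0
  rw [zero_add] at hg
  rw [hg t ht]
  simp [Nat.descFactorial_self, div_eq_inv_mul]

theorem deriv_xfun_succ_s17 (j : ℕ) {s : ℝ} (hs : 0 < s) :
    deriv (xfun (j + 1)) s = Real.log s ^ j + j * Real.log s ^ (j - 1) := by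
  have h := (hasDerivAt_id s).mul ((Real.hasDerivAt_log hs.ne').pow j)
  have hx : xfun (j + 1) = id * (Real.log ^ j) := by
    ext y
    simp [xfun]
  rw [hx, h.deriv]
  have : s ≠ 0 := hs.ne'
  simp
  field_simp

theorem contDiffAt_deriv_xfun_succ (j r : ℕ) {s : ℝ} (hs : 0 < s) :
    ContDiffAt ℝ r (deriv (xfun (j + 1))) s := by
  have hl : ContDiffAt ℝ r Real.log s := Real.contDiffAt_log.2 hs.ne'
  refine ((hl.pow j).add
    ((contDiffAt_const (c := (j : ℝ))).mul (hl.pow (j - 1)))).congr_of_eventuallyEq ?_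
  filter_upwards [lt_mem_nhds hs] with y hy
  simpa using deriv_xfun_succ_s17 j hy

open Polynomial in
theorem sum_coeff_mul_iteratedDeriv_deriv_xfun {N : ℕ} (q : ℝ[X]) (hq : q.natDegree ≤ N) (r : ℕ)
    {t : ℝ} (ht : 0 < t) :
    ∑ j : Fin (N + 1), iteratedDeriv r (deriv (xfun (j + 1))) t * q.coeff j =
      iteratedDeriv r (fun s => (q + derivative q).eval (Real.log s)) t := by
  have hev : (fun s => (q + derivative q).eval (Real.log s)) =ᶠ[nhds t]
      fun s => ∑ j : Fin (N + 1), q.coeff j * deriv (xfun (j + 1)) s := by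
    filter_upwards [lt_mem_nhds ht] with s hs
    rw [Fin.sum_univ_eq_sum_range (fun j => q.coeff j * deriv (xfun (j + 1)) s), eval_add,
      derivative_eval, q.sum_over_range' (by simp) (N + 1) (by omega),
      eval_eq_sum_range' (Nat.lt_succ_of_le hq), ← Finset.sum_add_distrib]
    refine Finset.sum_congr rfl fun j _ => ?_
    rw [deriv_xfun_succ_s17 j hs]
    ring
  rw [hev.iteratedDeriv_eq, iteratedDeriv_fun_sum fun j _ =>
    contDiffAt_const.mul (contDiffAt_deriv_xfun_succ _ r ht)]
  refine Finset.sum_congr rfl fun j _ => ?_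
  rw [iteratedDeriv_const_mul_field, mul_comm]

open Polynomial in
/-- The truncated inverse `∑_{l < N} (-d/dX)^l` of the operator `1 + d/dX` on polynomials. -/
noncomputable def altDerivSum (N : ℕ) : Module.End ℝ ℝ[X] :=
  ∑ l ∈ Finset.range N, (-(derivative : Module.End ℝ ℝ[X])) ^ l

open Polynomial in
theorem neg_derivative_pow_apply (l : ℕ) (p : ℝ[X]) :
    ((-(derivative : Module.End ℝ ℝ[X])) ^ l) p = (-1) ^ l * derivative^[l] p := by
  induction l with
  | zero => simp
  | succ l ih =>
    rw [pow_succ', Module.End.mul_apply, ih, Function.iterate_succ_apply', LinearMap.neg_apply,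
      show ((-1 : ℝ[X]) ^ l) = C ((-1) ^ l) by simp, derivative_C_mul, pow_succ]
    simp

open Polynomial in
theorem altDerivSum_add_derivative {N : ℕ} {p : ℝ[X]} (hp : p.natDegree < N) :
    altDerivSum N p + derivative (altDerivSum N p) = p := by
  have h := congrArg (fun f : Module.End ℝ ℝ[X] => f p)
    (mul_neg_geom_sum (-(derivative : Module.End ℝ ℝ[X])) N)
  simp only [sub_neg_eq_add, Module.End.mul_apply, LinearMap.add_apply, LinearMap.sub_apply,
    Module.End.one_apply, neg_derivative_pow_apply, iterate_derivative_eq_zero hp] at h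
  simpa [altDerivSum] using h

open Polynomial in
theorem natDegree_altDerivSum_le (N : ℕ) (p : ℝ[X]) :
    (altDerivSum N p).natDegree ≤ p.natDegree := by
  rw [altDerivSum, LinearMap.sum_apply]
  refine natDegree_sum_le_of_forall_le _ _ fun l _ => ?_
  rw [neg_derivative_pow_apply]
  have h : ((-1 : ℝ[X]) ^ l) = C ((-1) ^ l) := by simp
  rw [h]
  exact (natDegree_C_mul_le _ _).trans ((natDegree_iterate_derivative _ _).trans (Nat.sub_le _ _))

open Polynomial in
theorem coeff_altDerivSum_natDegree {N : ℕ} {p : ℝ[X]} (hp : p.natDegree < N) :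
    (altDerivSum N p).coeff p.natDegree = p.leadingCoeff := by
  have h := congrArg (fun q => q.coeff p.natDegree) (altDerivSum_add_derivative hp)
  simp only [coeff_add, coeff_derivative] at h
  rw [coeff_eq_zero_of_natDegree_lt (n := p.natDegree + 1)
    (Nat.lt_succ_of_le (natDegree_altDerivSum_le N p))] at h
  simpa using h

open Polynomial in
theorem altDerivSum_one {N : ℕ} (hN : 0 < N) : altDerivSum N 1 = 1 := by
  obtain ⟨N, rfl⟩ := Nat.exists_eq_succ_of_ne_zero hN.ne'
  rw [altDerivSum, Finset.sum_range_succ', LinearMap.add_apply, LinearMap.sum_apply,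
    Finset.sum_eq_zero]
  · simp
  · intro l _
    rw [neg_derivative_pow_apply, iterate_derivative_eq_zero (by simp), mul_zero]

/-- The matrix with first row `x`, whose remaining rows hold the derivatives of orders `1` to `N`
of the functions `xfun 1, …, xfun (N + 1)` at `t`. -/
noncomputable def borderedWronskian {N : ℕ} (x : Fin (N + 1) → ℝ) (t : ℝ) :
    Matrix (Fin (N + 1)) (Fin (N + 1)) ℝ :=
  Matrix.of (Fin.cons x fun (r : Fin N) j => iteratedDeriv (r : ℕ) (deriv (xfun (j + 1))) t)

theorem sum_Wkn_mul_eq_det_borderedWronskian {N : ℕ} (x : Fin (N + 1) → ℝ) (t : ℝ) :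
    ∑ j : Fin (N + 1), (-1 : ℝ) ^ ((j : ℕ) + 1 + 1) * Wkn (N + 1) ((j : ℕ) + 1) t * x j =
      (borderedWronskian x t).det := by
  rw [Matrix.det_succ_row_zero]
  refine Finset.sum_congr rfl fun j _ => ?_
  have hW : Wkn (N + 1) ((j : ℕ) + 1) t =
      ((borderedWronskian x t).submatrix Fin.succ j.succAbove).det := by
    unfold Wkn
    refine congrArg Matrix.det (Matrix.ext fun r m => ?_)
    simp only [borderedWronskian, Matrix.of_apply, Matrix.submatrix_apply, Fin.cons_succ]
    congr 3
    rcases lt_or_ge (m : ℕ) (j : ℕ) with h | h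
    · rw [if_pos (Nat.succ_lt_succ h), Fin.succAbove_of_castSucc_lt _ _ h]
      rfl
    · rw [if_neg (by simpa using h), Fin.succAbove_of_le_castSucc _ _ h]
      rfl
  rw [hW]
  simp only [borderedWronskian, Matrix.of_apply, Fin.cons_zero]
  ring

open Polynomial in
theorem det_borderedWronskian {N : ℕ} (x : Fin (N + 1) → ℝ) {t : ℝ} (ht : 0 < t) :
    (borderedWronskian x t).det =
      (-1) ^ N *
        (∑ j : Fin (N + 1), x j * (altDerivSum (N + 1) ((X - C (Real.log t)) ^ N)).coeff j) *
        ∏ k ∈ Finset.range N, ((k.factorial : ℝ) / t ^ k) := by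
  set q : ℕ → ℝ[X] := fun k => altDerivSum (N + 1) ((X - C (Real.log t)) ^ k) with hq
  have hdeg (k : ℕ) : ((X - C (Real.log t)) ^ k).natDegree = k := by simp
  have hqdeg (k : ℕ) : (q k).natDegree ≤ k :=
    (natDegree_altDerivSum_le _ _).trans (hdeg k).le
  have hqD {k : ℕ} (hk : k < N + 1) : q k + derivative (q k) = (X - C (Real.log t)) ^ k :=
    altDerivSum_add_derivative (by rwa [hdeg])
  have hqlead {k : ℕ} (hk : k < N + 1) : (q k).coeff k = 1 := by
    have h := coeff_altDerivSum_natDegree (N := N + 1) (p := (X - C (Real.log t)) ^ k)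
      (by rwa [hdeg])
    rwa [hdeg, ((monic_X_sub_C _).pow k).leadingCoeff] at h
  set E : Matrix (Fin (N + 1)) (Fin (N + 1)) ℝ := Matrix.of fun j k => (q k).coeff j with hE
  have hdetE : E.det = 1 := by
    rw [Matrix.det_of_isUpperTriangular]
    · exact Finset.prod_eq_one fun k _ => hqlead k.2
    · intro j k hjk
      exact coeff_eq_zero_of_natDegree_lt ((hqdeg k).trans_lt hjk)
  have hzero (k : Fin (N + 1)) :
      (borderedWronskian x t * E) 0 k = ∑ j : Fin (N + 1), x j * (q k).coeff j := by
    simp [Matrix.mul_apply, borderedWronskian, hE]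
  have hsucc (r : Fin N) (k : Fin (N + 1)) : (borderedWronskian x t * E) r.succ k =
      iteratedDeriv (r : ℕ) (fun s => (Real.log s - Real.log t) ^ (k : ℕ)) t := by
    have h := sum_coeff_mul_iteratedDeriv_deriv_xfun (q k)
      ((hqdeg k).trans (Nat.le_of_lt_succ k.2)) r ht
    rw [hqD k.2] at h
    simpa [Matrix.mul_apply, borderedWronskian, hE] using h
  rw [← mul_one (borderedWronskian x t).det, ← hdetE, ← Matrix.det_mul,
    Matrix.det_succ_column _ (Fin.last N), Fin.sum_univ_succ, Finset.sum_eq_zero, hzero, add_zero]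
  · rw [Matrix.det_of_isLowerTriangular]
    · simp only [Matrix.submatrix_apply, Fin.succAbove_zero, Fin.succAbove_last, hsucc,
        Fin.val_castSucc, iteratedDeriv_log_sub_pow_self ht]
      rw [Fin.prod_univ_eq_prod_range (fun k => (k.factorial : ℝ) / t ^ k), hdetE]
      simp [hq]
    · intro r k hrk
      simp only [Matrix.submatrix_apply, Fin.succAbove_zero, Fin.succAbove_last, hsucc]
      exact iteratedDeriv_log_sub_pow_of_lt ht hrk
  · intro r _
    rw [hsucc, iteratedDeriv_log_sub_pow_of_lt ht (by simp), mul_zero, zero_mul]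

open Polynomial in
theorem sum_nodes_X_sub_C_pow {N : ℕ} {u : Fin (N + 1) → ℝ} (hu : Function.Injective u) :
    ∑ i, C ((-1) ^ N / ∏ k ∈ Finset.univ.erase i, (u i - u k)) * (X - C (u i)) ^ N = 1 := by
  refine Polynomial.funext fun y => ?_
  have hd : ((C y - X : ℝ[X]) ^ N) = C ((-1) ^ N) * (X - C y) ^ N := by
    rw [← neg_sub, neg_pow]
    simp
  have hn : ((C y - X : ℝ[X]) ^ N).natDegree ≤ N := by
    rw [hd]
    exact (natDegree_C_mul_le _ _).trans (by simp)
  have h := Lagrange.coeff_eq_sum (s := Finset.univ) (v := u) hu.injOn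
    (P := (C y - X) ^ N) (by
      rw [Finset.card_univ, Fintype.card_fin]
      exact (degree_le_of_natDegree_le hn).trans_lt (Nat.cast_lt.2 N.lt_succ_self))
  have hc : ((X - C y : ℝ[X]) ^ N).coeff N = 1 := by
    have := ((monic_X_sub_C y).pow N).coeff_natDegree
    simpa using this
  rw [Finset.card_univ, Fintype.card_fin, Nat.add_sub_cancel, hd, coeff_C_mul, hc, mul_one,
    ← hd] at h
  rw [eval_finsetSum, eval_one]
  have hs : ((-1 : ℝ) ^ N) * (-1) ^ N = 1 := by rw [← mul_pow]; simp
  have hone : (-1 : ℝ) ^ N * ∑ i, eval (u i) ((C y - X) ^ N) /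
      ∏ j ∈ Finset.univ.erase i, (u i - u j) = 1 := by rw [← h, hs]
  refine Eq.trans ?_ hone
  rw [Finset.mul_sum]
  refine Finset.sum_congr rfl fun i _ => ?_
  simp only [eval_mul, eval_C, eval_pow, eval_sub, eval_X]
  ring

open Polynomial in
theorem eq_zero_of_sum_C_mul_X_sub_C_pow {N : ℕ} {u z : Fin (N + 1) → ℝ}
    (hu : Function.Injective u) (h : ∑ i, C (z i) * (X - C (u i)) ^ N = 0) : z = 0 := by
  refine Matrix.eq_zero_of_forall_pow_sum_mul_pow_eq_zero (f := fun i => -u i)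
    (fun i j hij => hu (neg_injective hij)) fun m => ?_
  have hm : (m : ℕ) ≤ N := Nat.le_of_lt_succ m.2
  have hc := congrArg (fun p => p.coeff (N - m)) h
  simp only [finsetSum_coeff, coeff_C_mul, sub_eq_add_neg, ← C_neg, coeff_X_add_C_pow,
    coeff_zero, Nat.sub_sub_self hm, ← mul_assoc] at hc
  rw [← Finset.sum_mul] at hc
  exact (mul_eq_zero.1 hc).resolve_right
    (by exact_mod_cast (Nat.choose_pos (Nat.sub_le N m)).ne')

open Polynomial in
theorem det_ne_zero_of_coeff_altDerivSum {N : ℕ} {u c : Fin (N + 1) → ℝ}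
    (hu : Function.Injective u) (hc : ∀ i, c i ≠ 0)
    {A : Matrix (Fin (N + 1)) (Fin (N + 1)) ℝ}
    (hA : ∀ i j, A i j = c i * (altDerivSum (N + 1) ((X - C (u i)) ^ N)).coeff j) :
    A.det ≠ 0 := by
  rw [Ne, ← Matrix.exists_vecMul_eq_zero_iff]
  rintro ⟨y, hy0, hy⟩
  set p : ℝ[X] := ∑ i, C (y i * c i) * (X - C (u i)) ^ N with hp
  have hdeg : p.natDegree ≤ N :=
    natDegree_sum_le_of_forall_le _ _ fun i _ => (natDegree_C_mul_le _ _).trans (by simp)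
  have hS : altDerivSum (N + 1) p = 0 := by
    ext j
    rcases lt_or_ge j (N + 1) with hj | hj
    · have h := congrFun hy ⟨j, hj⟩
      simp only [Matrix.vecMul, dotProduct, hA, Pi.zero_apply, ← mul_assoc] at h
      simpa only [hp, map_sum, ← smul_eq_C_mul, map_smul, finsetSum_coeff, coeff_smul,
        smul_eq_mul, coeff_zero] using h
    · rw [coeff_eq_zero_of_natDegree_lt
        ((natDegree_altDerivSum_le _ _).trans_lt (hdeg.trans_lt hj)), coeff_zero]
  have hp0 : p = 0 := by
    rw [← altDerivSum_add_derivative (Nat.lt_succ_of_le hdeg), hS]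
    simp
  have hz := eq_zero_of_sum_C_mul_X_sub_C_pow hu hp0
  exact hy0 (funext fun i => (mul_eq_zero.1 (congrFun hz i)).resolve_right (hc i))

open Polynomial in
theorem apply_zero_eq_sum_nodes {N : ℕ} {u : Fin (N + 1) → ℝ} (hu : Function.Injective u)
    (x : Fin (N + 1) → ℝ) :
    x 0 = ∑ i, (-1) ^ N / (∏ k ∈ Finset.univ.erase i, (u i - u k)) *
      ∑ j : Fin (N + 1), x j * (altDerivSum (N + 1) ((X - C (u i)) ^ N)).coeff j := by
  have h : x 0 = ∑ j : Fin (N + 1), x j * (altDerivSum (N + 1) 1).coeff j := by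
    rw [altDerivSum_one N.succ_pos, Fin.sum_univ_succ, Finset.sum_eq_zero]
    · simp
    · intro j _
      rw [coeff_one, if_neg (by simp), mul_zero]
  rw [h, ← sum_nodes_X_sub_C_pow hu]
  simp only [map_sum, ← smul_eq_C_mul, map_smul, finsetSum_coeff, coeff_smul, smul_eq_mul,
    Finset.mul_sum]
  rw [Finset.sum_comm]
  refine Finset.sum_congr rfl fun i _ => Finset.sum_congr rfl fun j _ => ?_
  ring

theorem kfun_succ {N : ℕ} (hN : 2 ≤ N) {t : ℝ} (ht : 0 < t) :
    kfun (N + 1) t =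
      N.factorial * t * ∏ k ∈ Finset.range N, ((k.factorial : ℝ) / t ^ k) := by
  obtain ⟨M, rfl⟩ := Nat.exists_eq_add_of_le' hN
  have hexp : ∑ k ∈ Finset.range (M + 2), k = (M + 2 + 1) * (M + 2 + 1 - 3) / 2 + 1 := by
    rw [Finset.sum_range_id, show (M + 2) * (M + 2 - 1) = (M + 2 + 1) * (M + 2 + 1 - 3) + 2 by
      rw [show M + 2 - 1 = M + 1 by omega, show M + 2 + 1 - 3 = M by omega]
      ring]
    omega
  rw [kfun, Finset.prod_div_distrib, Finset.prod_pow_eq_pow_sum, hexp, Finset.prod_range_succ]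
  have : t ≠ 0 := ht.ne'
  rw [pow_succ]
  field_simp

theorem stmt_17 (n : ℕ) (hn : 3 ≤ n) (a : Fin n → ℝ)
    (ha0 : ∀ i, 0 < a i) (hmono : StrictMono a)
    (A : Matrix (Fin n) (Fin n) ℝ)
    (hA : A = Matrix.of fun i j : Fin n =>
      (-1 : ℝ) ^ ((j : ℕ) + 1 + 1) * Wkn n ((j : ℕ) + 1) (a i))
    (b : Fin n → ℝ) (hb : b = fun i => kfun n (a i)) :
    IsUnit A ∧ (∃! x : Fin n → ℝ, A.mulVec x = b) ∧
      ∀ x : Fin n → ℝ, A.mulVec x = b →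
        x ⟨0, by omega⟩ =
          (Nat.factorial (n - 1) : ℝ) *
            ∑ j : Fin n, a j / ∏ i ∈ Finset.univ.erase j,
              (Real.log (a j) - Real.log (a i)) := by
  obtain ⟨N, rfl⟩ : ∃ N, n = N + 1 := ⟨n - 1, by omega⟩
  have hu : Function.Injective fun i => Real.log (a i) := fun i j hij =>
    hmono.injective (Real.log_injOn_pos (ha0 i) (ha0 j) hij)
  set c : Fin (N + 1) → ℝ := fun i => ∏ k ∈ Finset.range N, ((k.factorial : ℝ) / a i ^ k) with hc
  have hc0 (i) : c i ≠ 0 := Finset.prod_ne_zero_iff.2 fun k _ =>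
    div_ne_zero (by exact_mod_cast k.factorial_ne_zero) (pow_ne_zero _ (ha0 i).ne')
  set Q : Fin (N + 1) → Polynomial ℝ := fun i =>
    altDerivSum (N + 1) ((Polynomial.X - Polynomial.C (Real.log (a i))) ^ N) with hQ
  have hAx (x : Fin (N + 1) → ℝ) (i) :
      A.mulVec x i = (-1) ^ N * (∑ j : Fin (N + 1), x j * (Q i).coeff j) * c i := by
    rw [← det_borderedWronskian x (ha0 i), ← sum_Wkn_mul_eq_det_borderedWronskian, hA]
    rfl
  have hAij (i j) : A i j = (-1) ^ N * c i * (Q i).coeff j := by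
    have h := hAx (Pi.single j 1) i
    rw [Matrix.mulVec_single_one] at h
    simp only [Matrix.col_apply, Pi.single_apply, ite_mul, one_mul, zero_mul, Finset.sum_ite_eq',
      Finset.mem_univ, if_true] at h
    rw [h]
    ring
  have hdet : A.det ≠ 0 := det_ne_zero_of_coeff_altDerivSum hu
    (fun i => mul_ne_zero (pow_ne_zero N (by norm_num)) (hc0 i)) hAij
  have hunit : IsUnit A := (Matrix.isUnit_iff_isUnit_det A).2 hdet.isUnit
  refine ⟨hunit, ?_, fun x hx => ?_⟩
  · exact Function.Bijective.existsUnique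
      ⟨Matrix.mulVec_injective_iff_isUnit.2 hunit, Matrix.mulVec_surjective_iff_isUnit.2 hunit⟩ b
  · have hxi (i) : (-1) ^ N * ∑ j : Fin (N + 1), x j * (Q i).coeff j = N.factorial * a i := by
      have h := hAx x i
      rw [hx, hb] at h
      change kfun (N + 1) (a i) = _ at h
      rw [kfun_succ (by omega) (ha0 i)] at h
      exact (mul_right_cancel₀ (hc0 i) h).symm
    refine (apply_zero_eq_sum_nodes hu x).trans ?_
    rw [Nat.add_sub_cancel, Finset.mul_sum]
    refine Finset.sum_congr rfl fun i _ => ?_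
    rw [div_mul_eq_mul_div, hxi, mul_div_assoc]
end
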